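/- arXiv:2511.12887 — 7 statements merged into one kernel-verified Lean document; each statement's English description precedes it below -/
import Mathlib

section
/- Let d ≥ 2, N, M ≥ 2 be integers with N(M−1) = d²−1, let {E_{α,k}} be an informationally complete (N,M)-POVM on ℂ^d with parameter x satisfying d/M² < x ≤ min{d²/M², d/M}, let O^{(1)},…,O^{(N)} be M×M real orthogonal matrices each fixing the all-ones vector, let 1 ≤ k ≤ d, and let Λ be the associated linear map with constant h_x = (1/(kd−1))·√(M(M−1)/(x(M²x−d))). Then for all unitary d×d matrices U and V, the matrix (id ⊗ Λ)(|ψ_k⟩⟨ψ_k|) is positive semidefinite, where |ψ_k⟩ = (U⊗V)·(1/√k)·∑_{i=0}^{k−1}|i⟩⊗|i⟩; that is, Λ is a k-positive map. -/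
open Matrix Kronecker
open scoped ComplexOrder

noncomputable section

/-- Informationally complete (N,M)-POVM on ℂ^d with parameter x. -/
def IsICPOVM (d N M : ℕ) (x : ℝ)
    (E : Fin N → Fin M → Matrix (Fin d) (Fin d) ℂ) : Prop :=
  (∀ α k, (E α k).PosSemidef) ∧
  (∀ α, ∑ k, E α k = 1) ∧
  (∀ α k, (E α k).trace = (d : ℂ) / M) ∧
  (∀ α k, (E α k * E α k).trace = (x : ℂ)) ∧
  (∀ α k l, k ≠ l → (E α k * E α l).trace = ((d : ℂ) - M * x) / (M * (M - 1))) ∧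
  (∀ α β k l, α ≠ β → (E α k * E β l).trace = (d : ℂ) / (M : ℂ) ^ 2) ∧
  ((d : ℝ) / (M : ℝ) ^ 2 < x ∧ x ≤ min ((d : ℝ) ^ 2 / (M : ℝ) ^ 2) ((d : ℝ) / M))

/-- The constant h_x. -/
def hx (d M k : ℕ) (x : ℝ) : ℝ :=
  (1 / ((k : ℝ) * d - 1)) *
    Real.sqrt (((M : ℝ) * ((M : ℝ) - 1)) / (x * ((M : ℝ) ^ 2 * x - d)))

/-- The linear map Λ associated to the POVM, the rotations and the constant h. -/
def LamMap {d N M : ℕ} (E : Fin N → Fin M → Matrix (Fin d) (Fin d) ℂ)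
    (O : Fin N → Matrix (Fin M) (Fin M) ℝ) (h : ℝ)
    (X : Matrix (Fin d) (Fin d) ℂ) : Matrix (Fin d) (Fin d) ℂ :=
  (X.trace / d) • 1 -
    (h : ℂ) • ∑ α, ∑ g, ∑ l,
      ((O α g l : ℝ) : ℂ) • (((X - (X.trace / d) • 1) * E α l).trace • E α g)

/-- (id ⊗ Λ) acting on matrices on ℂ^d ⊗ ℂ^d. -/
def idTensor {d : ℕ} (Λ : Matrix (Fin d) (Fin d) ℂ → Matrix (Fin d) (Fin d) ℂ)
    (ρ : Matrix (Fin d × Fin d) (Fin d × Fin d) ℂ) :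
    Matrix (Fin d × Fin d) (Fin d × Fin d) ℂ :=
  Matrix.of fun p q => Λ (Matrix.of fun a b => ρ (p.1, a) (q.1, b)) p.2 q.2

/-- Rank-one projection |ψ⟩⟨ψ|. -/
def proj {n : Type*} (ψ : n → ℂ) : Matrix n n ℂ := Matrix.vecMulVec ψ (star ψ)

/-- The maximally entangled vector of Schmidt rank k, rotated by U ⊗ V. -/
def psiK (d k : ℕ) (U V : Matrix (Fin d) (Fin d) ℂ) : Fin d × Fin d → ℂ :=
  (U ⊗ₖ V).mulVec fun p =>
    if p.1 = p.2 ∧ (p.1 : ℕ) < k then (((1 : ℝ) / Real.sqrt k : ℝ) : ℂ) else 0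

/-- The Schmidt-number witness W_k. -/
def Wit {d N M : ℕ} (E : Fin N → Fin M → Matrix (Fin d) (Fin d) ℂ)
    (O : Fin N → Matrix (Fin M) (Fin M) ℝ) (h : ℝ) :
    Matrix (Fin d × Fin d) (Fin d × Fin d) ℂ :=
  ((((M : ℝ) + N * d * h) / (d * M) : ℝ) : ℂ) • 1 -
    (h : ℂ) • ∑ α, ∑ g, ∑ l,
      ((O α g l : ℝ) : ℂ) • ((E α l).map (starRingEnd ℂ) ⊗ₖ E α g)

/-- ρ has Schmidt number at most k. -/
def SchmidtNumberLE (d k : ℕ) (ρ : Matrix (Fin d × Fin d) (Fin d × Fin d) ℂ) : Prop :=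
  ∃ (n : ℕ) (p : Fin n → ℝ) (ψ : Fin n → (Fin d × Fin d → ℂ)),
    (∀ i, 0 ≤ p i) ∧ (∑ i, p i = 1) ∧
    (∀ i, ∑ q, ‖ψ i q‖ ^ 2 = 1) ∧
    (∀ i, (Matrix.of fun a b => ψ i (a, b)).rank ≤ k) ∧
    ρ = ∑ i, ((p i : ℝ) : ℂ) • proj (ψ i)

/-- The maximally entangled vector |ψ_d⟩. -/
def psiD (d : ℕ) : Fin d × Fin d → ℂ :=
  fun p => if p.1 = p.2 then (((1 : ℝ) / Real.sqrt d : ℝ) : ℂ) else 0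

/-- The isotropic state ρ_v. -/
def isoState (d : ℕ) (v : ℝ) : Matrix (Fin d × Fin d) (Fin d × Fin d) ℂ :=
  (v : ℂ) • proj (psiD d) + (((1 - v) / (d : ℝ) ^ 2 : ℝ) : ℂ) • 1

/-- The traceless part of a matrix. -/
def tracelessPart {d : ℕ} (X : Matrix (Fin d) (Fin d) ℂ) : Matrix (Fin d) (Fin d) ℂ :=
  X - (X.trace / d) • 1

lemma tracelessPart_add {d : ℕ} (X Y : Matrix (Fin d) (Fin d) ℂ) :
    tracelessPart (X + Y) = tracelessPart X + tracelessPart Y := by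
  simp only [tracelessPart, Matrix.trace_add, add_div, add_smul]
  abel

lemma tracelessPart_smul {d : ℕ} (a : ℂ) (X : Matrix (Fin d) (Fin d) ℂ) :
    tracelessPart (a • X) = a • tracelessPart X := by
  simp only [tracelessPart, Matrix.trace_smul, smul_eq_mul, mul_div_assoc, smul_sub, smul_smul]

lemma conjTranspose_tracelessPart {d : ℕ} (X : Matrix (Fin d) (Fin d) ℂ) :
    (tracelessPart X)ᴴ = tracelessPart Xᴴ := by
  simp [tracelessPart, Matrix.conjTranspose_smul, Matrix.trace_conjTranspose]

lemma lamMap_eq {d N M : ℕ} (E : Fin N → Fin M → Matrix (Fin d) (Fin d) ℂ)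
    (O : Fin N → Matrix (Fin M) (Fin M) ℝ) (h : ℝ) (X : Matrix (Fin d) (Fin d) ℂ) :
    LamMap E O h X = (X.trace / d) • 1 - (h : ℂ) • ∑ α, ∑ g, ∑ l,
      ((O α g l : ℝ) : ℂ) • ((tracelessPart X * E α l).trace • E α g) :=
  rfl

lemma trace_tracelessPart {d : ℕ} (hd : d ≠ 0) (X : Matrix (Fin d) (Fin d) ℂ) :
    (tracelessPart X).trace = 0 := by
  have : (d : ℂ) ≠ 0 := by exact_mod_cast hd
  simp [tracelessPart, Matrix.trace_sub, Matrix.trace_smul, this]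

lemma trace_conjTranspose_mul_self_tracelessPart {d : ℕ} (hd : d ≠ 0)
    (X : Matrix (Fin d) (Fin d) ℂ) :
    ((tracelessPart X)ᴴ * tracelessPart X).trace =
      (Xᴴ * X).trace - (‖X.trace‖ ^ 2 / d : ℝ) := by
  have hd' : (d : ℂ) ≠ 0 := by exact_mod_cast hd
  have h1 : ((tracelessPart X)ᴴ * tracelessPart X).trace =
      (Xᴴ * tracelessPart X).trace := by
    conv_lhs => rw [tracelessPart, Matrix.conjTranspose_sub, Matrix.sub_mul,
      Matrix.trace_sub, ← tracelessPart]
    simp [Matrix.conjTranspose_smul, Matrix.trace_smul, trace_tracelessPart hd]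
  rw [h1, tracelessPart, Matrix.mul_sub, Matrix.trace_sub]
  simp only [Matrix.mul_smul, Matrix.mul_one, Matrix.trace_smul, Matrix.trace_conjTranspose]
  push_cast
  rw [← Complex.conj_mul']
  simp only [smul_eq_mul, RCLike.star_def]
  ring

/-- Bessel's inequality for the frame of POVM elements on traceless matrices. -/
lemma IsICPOVM.sum_norm_trace_mul_sq_le {d N M : ℕ} {x : ℝ}
    {E : Fin N → Fin M → Matrix (Fin d) (Fin d) ℂ} (hE : IsICPOVM d N M x E) (hM : 2 ≤ M)
    {X : Matrix (Fin d) (Fin d) ℂ} (hX : X.trace = 0) :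
    ∑ α, ∑ l, ‖(X * E α l).trace‖ ^ 2 ≤
      ((M : ℝ) ^ 2 * x - d) / (M * (M - 1)) * ((Xᴴ * X).trace).re := by
  obtain ⟨hpos, hsum, -, hdiag, hoff, hne, hx1, -⟩ := hE
  have hM' : (2 : ℝ) ≤ M := by exact_mod_cast hM
  set b : ℝ := ((M : ℝ) ^ 2 * x - d) / (M * (M - 1)) with hb
  have hbpos : 0 < b := by
    rw [div_lt_iff₀ (by positivity)] at hx1
    apply div_pos (by linarith) (mul_pos (by linarith) (by linarith))
  set c : Fin N → Fin M → ℂ := fun α l => (X * E α l).trace with hc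
  have hcsum : ∀ α, ∑ l, c α l = 0 := fun α => by
    simp only [hc, ← Matrix.trace_sum, ← Matrix.mul_sum, hsum, Matrix.mul_one, hX]
  set S : Matrix (Fin d) (Fin d) ℂ := ∑ α, ∑ l, c α l • E α l with hS
  set A : ℝ := ∑ α, ∑ l, ‖c α l‖ ^ 2 with hA
  have hherm : ∀ α l, (E α l)ᴴ = E α l := fun α l => (hpos α l).isHermitian
  have hSE : ∀ β m, (E β m * S).trace = b * c β m := by
    intro β m
    have hα : ∀ α, ∑ l, c α l * (E β m * E α l).trace = if α = β then b * c β m else 0 := by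
      intro α
      split_ifs with h
      · subst h
        set y : ℂ := ((d : ℂ) - M * x) / (M * (M - 1)) with hy
        have hxy : (x : ℂ) = y + b := by
          have h0 : (M : ℝ) ≠ 0 := by linarith
          have h1 : (M : ℝ) - 1 ≠ 0 := by linarith
          have : x = (d - M * x) / (M * (M - 1)) + b := by
            rw [hb]; field_simp; ring
          rw [hy]; exact_mod_cast this
        have : ∀ l, c α l * (E α m * E α l).trace =
            c α l * y + if l = m then b * c α m else 0 := by
          intro l
          split_ifs with h
          · subst h; rw [hdiag, hxy]; ring
          · rw [hoff α m l (Ne.symm h)]; ring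
        simp [this, Finset.sum_add_distrib, ← Finset.sum_mul, hcsum]
      · simp [hne β α m _ (Ne.symm h), ← Finset.sum_mul, hcsum]
    simp only [hS, Matrix.mul_sum, Matrix.trace_sum, Matrix.mul_smul, Matrix.trace_smul,
      smul_eq_mul, hα]
    simp
  have hstar : ∀ Y : Matrix (Fin d) (Fin d) ℂ,
      (Sᴴ * Y).trace = ∑ α, ∑ l, star (c α l) * (E α l * Y).trace := by
    intro Y
    simp [hS, Matrix.conjTranspose_sum, Matrix.conjTranspose_smul, hherm, Finset.sum_mul,
      Matrix.trace_sum]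
  have hAc : (A : ℂ) = ∑ α, ∑ l, star (c α l) * c α l := by
    simp [hA, Complex.conj_mul']
  have hSX : (Sᴴ * X).trace = A := by
    rw [hstar, hAc]
    simp only [hc, Matrix.trace_mul_comm X]
  have hSS : (Sᴴ * S).trace = b * A := by
    rw [hstar, hAc]
    simp only [hSE, Finset.mul_sum]
    refine Finset.sum_congr rfl fun α _ => Finset.sum_congr rfl fun l _ => ?_
    ring
  have hXS : (Xᴴ * S).trace = A := by
    have : Xᴴ * S = (Sᴴ * X)ᴴ := by simp
    rw [this, Matrix.trace_conjTranspose, hSX]; simp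
  have hnn : 0 ≤ ((((b : ℂ) • X - S)ᴴ * ((b : ℂ) • X - S)).trace).re :=
    (Complex.le_def.1 (Matrix.posSemidef_conjTranspose_mul_self _).trace_nonneg).1
  have hexp : (((b : ℂ) • X - S)ᴴ * ((b : ℂ) • X - S)).trace =
      b * b * (Xᴴ * X).trace - b * A := by
    simp only [Matrix.conjTranspose_sub, Matrix.conjTranspose_smul, Matrix.sub_mul,
      Matrix.mul_sub, Matrix.trace_sub, Matrix.smul_mul, Matrix.mul_smul, Matrix.trace_smul,
      hSX, hXS, hSS, smul_eq_mul, RCLike.star_def, Complex.conj_ofReal]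
    ring
  rw [hexp] at hnn
  have h2 : ((b : ℂ) * b * (Xᴴ * X).trace - b * A).re = b * (b * (Xᴴ * X).trace.re - A) := by
    rw [← Complex.ofReal_mul, ← Complex.ofReal_mul, Complex.sub_re, Complex.re_ofReal_mul,
      Complex.ofReal_re]
    ring
  rw [h2] at hnn
  linarith [nonneg_of_mul_nonneg_right hnn hbpos]

lemma sum_norm_sq_mulVec_of_transpose_mul_self {M : ℕ} {O : Matrix (Fin M) (Fin M) ℝ}
    (hO : Oᵀ * O = 1) (c : Fin M → ℂ) :
    ∑ g, ‖∑ l, (O g l : ℂ) * c l‖ ^ 2 = ∑ l, ‖c l‖ ^ 2 := by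
  set P : Matrix (Fin M) (Fin M) ℂ := O.map Complex.ofRealHom with hP
  have hPP : Pᴴ * P = 1 := by
    have h1 : Pᴴ = Oᵀ.map Complex.ofRealHom := by ext i j; simp [hP]
    rw [h1, hP, ← Matrix.map_mul, hO, Matrix.map_one _ (by simp) (by simp)]
  have h : star (P *ᵥ c) ⬝ᵥ (P *ᵥ c) = star c ⬝ᵥ c := by
    rw [Matrix.star_mulVec, ← Matrix.dotProduct_mulVec, Matrix.mulVec_mulVec, hPP,
      Matrix.one_mulVec]
  have hnorm : ∀ w : Fin M → ℂ, star w ⬝ᵥ w = ((∑ l, ‖w l‖ ^ 2 : ℝ) : ℂ) := by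
    intro w
    simp [dotProduct, Complex.conj_mul']
  rw [hnorm, hnorm] at h
  exact_mod_cast h

lemma sum_col_eq_one_of_transpose_mul_self {M : ℕ} {O : Matrix (Fin M) (Fin M) ℝ}
    (hO : Oᵀ * O = 1) (hOnes : O *ᵥ (fun _ => 1) = fun _ => 1) (l : Fin M) :
    ∑ g, O g l = 1 := by
  have h : Oᵀ *ᵥ (fun _ => 1) = fun _ => 1 := by
    conv_lhs => rw [← hOnes, Matrix.mulVec_mulVec, hO, Matrix.one_mulVec]
  simpa [Matrix.mulVec, dotProduct] using congrFun h l

lemma star_dotProduct_mulVec_eq_trace {d : ℕ} (A : Matrix (Fin d) (Fin d) ℂ)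
    (u w : Fin d → ℂ) :
    star u ⬝ᵥ A *ᵥ w = (Matrix.vecMulVec w (star u) * A).trace := by
  rw [Matrix.vecMulVec_mul, Matrix.trace_vecMulVec, Matrix.dotProduct_mulVec, dotProduct_comm]

/-- The quadratic form of `LamMap`, expressed through traceless parts. -/
lemma IsICPOVM.star_dotProduct_lamMap_mulVec {d N M : ℕ} {x : ℝ}
    {E : Fin N → Fin M → Matrix (Fin d) (Fin d) ℂ} (hE : IsICPOVM d N M x E) (hd : d ≠ 0)
    {O : Fin N → Matrix (Fin M) (Fin M) ℝ} (hO : ∀ α, (O α)ᵀ * O α = 1)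
    (hOnes : ∀ α, (O α).mulVec (fun _ => 1) = fun _ => 1) (h : ℝ)
    (X : Matrix (Fin d) (Fin d) ℂ) (u w : Fin d → ℂ) :
    star u ⬝ᵥ LamMap E O h X *ᵥ w = X.trace / d * (star u ⬝ᵥ w) -
      h * ∑ α, ∑ g, (∑ l, (O α g l : ℂ) * (tracelessPart X * E α l).trace) *
        (tracelessPart (Matrix.vecMulVec w (star u)) * E α g).trace := by
  obtain ⟨-, hsum, htr, -⟩ := hE
  have hzero : ∀ α, ∑ g, ∑ l, (O α g l : ℂ) * (tracelessPart X * E α l).trace = 0 := by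
    intro α
    rw [Finset.sum_comm]
    have hcol : ∀ l, ∑ g, (O α g l : ℂ) = 1 := fun l => by
      exact_mod_cast sum_col_eq_one_of_transpose_mul_self (hO α) (hOnes α) l
    simp only [← Finset.sum_mul, hcol, one_mul, ← Matrix.trace_sum, ← Matrix.mul_sum, hsum,
      Matrix.mul_one, trace_tracelessPart hd]
  have hQ : ∀ α g, (tracelessPart (Matrix.vecMulVec w (star u)) * E α g).trace =
      star u ⬝ᵥ E α g *ᵥ w - (star u ⬝ᵥ w) / d * (d / M) := by
    intro α g
    rw [tracelessPart, Matrix.sub_mul, Matrix.trace_sub, ← star_dotProduct_mulVec_eq_trace,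
      Matrix.smul_mul, Matrix.one_mul, Matrix.trace_smul, htr, Matrix.trace_vecMulVec,
      dotProduct_comm w, smul_eq_mul]
  have hR : ∀ α, ∑ g, (∑ l, (O α g l : ℂ) * (tracelessPart X * E α l).trace) *
        (tracelessPart (Matrix.vecMulVec w (star u)) * E α g).trace =
      ∑ g, (∑ l, (O α g l : ℂ) * (tracelessPart X * E α l).trace) *
        (star u ⬝ᵥ E α g *ᵥ w) := by
    intro α
    simp only [hQ, mul_sub, Finset.sum_sub_distrib, ← Finset.sum_mul, hzero, zero_mul, sub_zero]
  simp only [hR]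
  simp only [lamMap_eq, Matrix.sub_mulVec, dotProduct_sub, Matrix.smul_mulVec,
    Matrix.one_mulVec, dotProduct_smul, smul_eq_mul, Matrix.sum_mulVec, dotProduct_sum,
    Finset.sum_mul, mul_assoc]

lemma trace_conjTranspose_mul_self_vecMulVec {d : ℕ} (u w : Fin d → ℂ) :
    ((Matrix.vecMulVec w (star u))ᴴ * Matrix.vecMulVec w (star u)).trace =
      (star u ⬝ᵥ u) * (star w ⬝ᵥ w) := by
  rw [Matrix.conjTranspose_vecMulVec, star_star, Matrix.vecMulVec_mul_vecMulVec,
    Matrix.trace_vecMulVec, dotProduct_smul, dotProduct_comm u, smul_eq_mul, mul_comm]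

lemma star_dotProduct_self_eq_re {n : Type*} [Fintype n] (w : n → ℂ) :
    star w ⬝ᵥ w = ((star w ⬝ᵥ w).re : ℂ) := by
  rw [← Complex.eq_re_of_ofReal_le (r := 0)]
  exact_mod_cast dotProduct_star_self_nonneg w

lemma IsICPOVM.sum_norm_trace_tracelessPart_vecMulVec_sq_le {d N M : ℕ} {x : ℝ}
    {E : Fin N → Fin M → Matrix (Fin d) (Fin d) ℂ} (hE : IsICPOVM d N M x E) (hd : d ≠ 0)
    (hM : 2 ≤ M) (u w : Fin d → ℂ) :
    ∑ α, ∑ l, ‖(tracelessPart (Matrix.vecMulVec w (star u)) * E α l).trace‖ ^ 2 ≤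
      ((M : ℝ) ^ 2 * x - d) / (M * (M - 1)) *
        ((star u ⬝ᵥ u).re * (star w ⬝ᵥ w).re - ‖star u ⬝ᵥ w‖ ^ 2 / d) := by
  refine (hE.sum_norm_trace_mul_sq_le hM (trace_tracelessPart hd _)).trans_eq ?_
  rw [trace_conjTranspose_mul_self_tracelessPart hd, trace_conjTranspose_mul_self_vecMulVec,
    Matrix.trace_vecMulVec, dotProduct_comm w, star_dotProduct_self_eq_re u,
    star_dotProduct_self_eq_re w, ← Complex.ofReal_mul, ← Complex.ofReal_sub]
  simp only [Complex.ofReal_re]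

lemma hx_nonneg {d M k : ℕ} (hd : d ≠ 0) (hk : 1 ≤ k) (x : ℝ) : 0 ≤ hx d M k x := by
  have h : (1 : ℝ) ≤ k * d := by exact_mod_cast Nat.mul_pos hk (Nat.pos_of_ne_zero hd)
  exact mul_nonneg (one_div_nonneg.2 (by linarith)) (Real.sqrt_nonneg _)

lemma hx_mul_le {d M k : ℕ} (hd : 2 ≤ d) (hM : 2 ≤ M) (hk : 1 ≤ k) {x : ℝ}
    (hx1 : (d : ℝ) / (M : ℝ) ^ 2 < x) (hx2 : x ≤ d / M) :
    hx d M k x * (((M : ℝ) ^ 2 * x - d) / (M * (M - 1))) * (k * d - 1) ≤ 1 := by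
  have hM' : (2 : ℝ) ≤ M := by exact_mod_cast hM
  have hd' : (2 : ℝ) ≤ d := by exact_mod_cast hd
  have hk' : (1 : ℝ) ≤ k := by exact_mod_cast hk
  have hkd : (0 : ℝ) < k * d - 1 := by nlinarith
  have hx0 : 0 < x := lt_of_le_of_lt (by positivity) hx1
  rw [div_lt_iff₀ (by positivity)] at hx1
  rw [le_div_iff₀ (by positivity)] at hx2
  have hMM : (0 : ℝ) < M * (M - 1) := mul_pos (by linarith) (by linarith)
  have ha : 0 < (M : ℝ) ^ 2 * x - d := by linarith
  have hle : (M : ℝ) ^ 2 * x - d ≤ x * (M * (M - 1)) := by nlinarith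
  set a := (M : ℝ) ^ 2 * x - d
  set c := (M : ℝ) * (M - 1)
  have hs : Real.sqrt (c / (x * a)) * (a / c) ≤ 1 := by
    rw [← le_div_iff₀ (by positivity), Real.sqrt_le_left (by positivity), one_div_div,
      div_pow, div_le_div_iff₀ (by positivity) (by positivity)]
    nlinarith [mul_le_mul_of_nonneg_left hle (mul_nonneg hMM.le ha.le)]
  calc hx d M k x * (a / c) * (k * d - 1)
      = Real.sqrt (c / (x * a)) * (a / c) * (1 / (k * d - 1) * (k * d - 1)) := by
        rw [hx]; ring
    _ ≤ 1 := by rw [one_div_mul_cancel hkd.ne', mul_one]; exact hs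

/-- The quadratic form of the map on a vector of Schmidt rank at most `k`. -/
lemma IsICPOVM.sum_lamMap_re_nonneg {d N M k : ℕ} {x : ℝ}
    {E : Fin N → Fin M → Matrix (Fin d) (Fin d) ℂ} (hE : IsICPOVM d N M x E) (hd : 2 ≤ d)
    (hM : 2 ≤ M) (hk : 1 ≤ k)
    {O : Fin N → Matrix (Fin M) (Fin M) ℝ} (hO : ∀ α, (O α)ᵀ * O α = 1)
    (hOnes : ∀ α, (O α).mulVec (fun _ => 1) = fun _ => 1)
    {v : Fin k → Fin d → ℂ} (hv : ∀ m n, star (v m) ⬝ᵥ v n = if m = n then 1 else 0)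
    (w : Fin k → Fin d → ℂ) :
    0 ≤ (∑ m, ∑ n, star (w m) ⬝ᵥ
      LamMap E O (hx d M k x) (Matrix.vecMulVec (v m) (star (v n))) *ᵥ w n).re := by
  have hd0 : d ≠ 0 := by omega
  have hdR : (2 : ℝ) ≤ d := by exact_mod_cast hd
  have hkR : (1 : ℝ) ≤ k := by exact_mod_cast hk
  have hM' : (2 : ℝ) ≤ M := by exact_mod_cast hM
  have hkd : (0 : ℝ) ≤ k * d - 1 := by nlinarith
  have hx1 := hE.2.2.2.2.2.2.1
  have hx2 := hE.2.2.2.2.2.2.2.trans (min_le_right _ _)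
  have hmul := hx_mul_le hd hM hk hx1 hx2
  have hh := hx_nonneg (M := M) hd0 hk x
  set h := hx d M k x
  have hb : 0 ≤ ((M : ℝ) ^ 2 * x - d) / (M * (M - 1)) := by
    rw [div_lt_iff₀ (by positivity)] at hx1
    exact div_nonneg (by linarith) (mul_nonneg (by linarith) (by linarith))
  have hbess := hE.sum_norm_trace_tracelessPart_vecMulVec_sq_le hd0 hM
  set b := ((M : ℝ) ^ 2 * x - d) / (M * (M - 1))
  set T : ℝ := ∑ m, (star (w m) ⬝ᵥ w m).re with hT
  have hnn : ∀ m, 0 ≤ (star (w m) ⬝ᵥ w m).re := fun m =>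
    (Complex.le_def.1 (dotProduct_star_self_nonneg (w m))).1
  have hT0 : 0 ≤ T := Finset.sum_nonneg fun m _ => hnn m
  let c : Fin k → Fin k → Fin N → Fin M → ℂ := fun m n α l =>
    (tracelessPart (Matrix.vecMulVec (v m) (star (v n))) * E α l).trace
  let c' : Fin k → Fin k → Fin N → Fin M → ℂ := fun m n α g => ∑ l, (O α g l : ℂ) * c m n α l
  let e : Fin k → Fin k → Fin N → Fin M → ℂ := fun m n α g =>
    (tracelessPart (Matrix.vecMulVec (w n) (star (w m))) * E α g).trace
  have hform : (∑ m, ∑ n, star (w m) ⬝ᵥ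
      LamMap E O h (Matrix.vecMulVec (v m) (star (v n))) *ᵥ w n) =
      ((T / d : ℝ) : ℂ) - h * ∑ m, ∑ n, ∑ α, ∑ g, c' m n α g * e m n α g := by
    simp only [hE.star_dotProduct_lamMap_mulVec hd0 hO hOnes, Finset.sum_sub_distrib,
      ← Finset.mul_sum, Matrix.trace_vecMulVec]
    congr 1
    have : ∀ m n, v m ⬝ᵥ star (v n) = if n = m then 1 else 0 := fun m n => by
      rw [dotProduct_comm, hv]
    simp only [this, ite_div, one_div, zero_div, ite_mul, zero_mul, Finset.sum_ite_eq',
      Finset.mem_univ, if_true]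
    rw [← Finset.mul_sum, hT]
    push_cast
    rw [div_eq_inv_mul]
    congr 1
    exact Finset.sum_congr rfl fun m _ => star_dotProduct_self_eq_re _
  have hp : ∑ m, ∑ n, ∑ α, ∑ g, ‖c' m n α g‖ ^ 2 ≤ b * (k * (k * d - 1) / d) := by
    calc ∑ m, ∑ n, ∑ α, ∑ g, ‖c' m n α g‖ ^ 2
        = ∑ m, ∑ n, ∑ α, ∑ l, ‖c m n α l‖ ^ 2 := by
          simp only [c', sum_norm_sq_mulVec_of_transpose_mul_self (hO _)]
      _ ≤ ∑ m : Fin k, ∑ n : Fin k, b * (1 - (if n = m then 1 else 0) / d) := by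
          refine Finset.sum_le_sum fun m _ => Finset.sum_le_sum fun n _ => ?_
          refine (hbess (v n) (v m)).trans_eq ?_
          by_cases hnm : n = m <;> simp [hv, hnm]
      _ = b * (k * (k * d - 1) / d) := by
          have : (d : ℝ) ≠ 0 := by linarith
          simp only [← Finset.mul_sum, Finset.sum_sub_distrib, ← Finset.sum_div,
            Finset.sum_ite_eq', Finset.mem_univ, if_true, Finset.sum_const, Finset.card_univ,
            Fintype.card_fin, nsmul_eq_mul]
          field_simp
  have hq : ∑ m, ∑ n, ∑ α, ∑ g, ‖e m n α g‖ ^ 2 ≤ b * (T ^ 2 * (k * d - 1) / (k * d)) := by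
    have hdiag : T ^ 2 / k ≤ ∑ m, ∑ n, ‖star (w m) ⬝ᵥ w n‖ ^ 2 := by
      rw [div_le_iff₀' (by linarith)]
      calc T ^ 2 ≤ k * ∑ m, (star (w m) ⬝ᵥ w m).re ^ 2 := by
            simpa using sq_sum_le_card_mul_sum_sq (s := Finset.univ)
              (f := fun m => (star (w m) ⬝ᵥ w m).re)
        _ ≤ _ := by
            refine mul_le_mul_of_nonneg_left (Finset.sum_le_sum fun m _ => ?_) (by linarith)
            refine le_trans ?_ (Finset.single_le_sum
              (f := fun n => ‖star (w m) ⬝ᵥ w n‖ ^ 2) (fun n _ => sq_nonneg _)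
              (Finset.mem_univ m))
            exact pow_le_pow_left₀ (hnn m) (Complex.re_le_norm _) 2
    calc ∑ m, ∑ n, ∑ α, ∑ g, ‖e m n α g‖ ^ 2
        ≤ ∑ m, ∑ n, b * ((star (w m) ⬝ᵥ w m).re * (star (w n) ⬝ᵥ w n).re -
            ‖star (w m) ⬝ᵥ w n‖ ^ 2 / d) :=
          Finset.sum_le_sum fun m _ => Finset.sum_le_sum fun n _ => hbess (w m) (w n)
      _ = b * (T ^ 2 - (∑ m, ∑ n, ‖star (w m) ⬝ᵥ w n‖ ^ 2) / d) := by
          simp only [← Finset.mul_sum, Finset.sum_sub_distrib, ← Finset.sum_div,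
            ← Finset.sum_mul, ← hT, sq T]
      _ ≤ b * (T ^ 2 - T ^ 2 / k / d) := by gcongr
      _ = b * (T ^ 2 * (k * d - 1) / (k * d)) := by
          have : (d : ℝ) ≠ 0 := by linarith
          have : (k : ℝ) ≠ 0 := by linarith
          congr 1
          field_simp
  set S : ℂ := ∑ m, ∑ n, ∑ α, ∑ g, c' m n α g * e m n α g with hS
  have hCS : ‖S‖ ^ 2 ≤ (∑ m, ∑ n, ∑ α, ∑ g, ‖c' m n α g‖ ^ 2) *
      ∑ m, ∑ n, ∑ α, ∑ g, ‖e m n α g‖ ^ 2 := by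
    have h1 : ‖S‖ ≤ ∑ m, ∑ n, ∑ α, ∑ g, ‖c' m n α g‖ * ‖e m n α g‖ := by
      simp only [← norm_mul]
      exact norm_sum_le_of_le _ fun m _ => norm_sum_le_of_le _ fun n _ =>
        norm_sum_le_of_le _ fun α _ => norm_sum_le _ _
    refine (pow_le_pow_left₀ (norm_nonneg _) h1 2).trans ?_
    have := Finset.sum_mul_sq_le_sq_mul_sq
      (Finset.univ : Finset (Fin k × Fin k × Fin N × Fin M))
      (fun p => ‖c' p.1 p.2.1 p.2.2.1 p.2.2.2‖) (fun p => ‖e p.1 p.2.1 p.2.2.1 p.2.2.2‖)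
    simpa only [Fintype.sum_prod_type] using this
  have hSle : ‖S‖ ≤ b * T * (k * d - 1) / d := by
    refine le_of_sq_le_sq ?_ (by positivity)
    refine hCS.trans ((mul_le_mul hp hq (by positivity) (by positivity)).trans_eq ?_)
    have : (d : ℝ) ≠ 0 := by linarith
    have : (k : ℝ) ≠ 0 := by linarith
    field_simp
  rw [hform, Complex.sub_re, Complex.re_ofReal_mul, Complex.ofReal_re, sub_nonneg]
  calc h * S.re ≤ h * (b * T * (k * d - 1) / d) :=
        mul_le_mul_of_nonneg_left ((Complex.re_le_norm S).trans hSle) hh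
    _ = (h * b * (k * d - 1)) * (T / d) := by ring
    _ ≤ T / d := mul_le_of_le_one_left (by positivity) hmul

/-- `LamMap` as a linear map. -/
def lamMapLinear {d N M : ℕ} (E : Fin N → Fin M → Matrix (Fin d) (Fin d) ℂ)
    (O : Fin N → Matrix (Fin M) (Fin M) ℝ) (h : ℝ) :
    Matrix (Fin d) (Fin d) ℂ →ₗ[ℂ] Matrix (Fin d) (Fin d) ℂ where
  toFun := LamMap E O h
  map_add' X Y := by
    simp only [lamMap_eq, tracelessPart_add, Matrix.add_mul, Matrix.trace_add, add_smul, smul_add,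
      Finset.sum_add_distrib, add_div]
    abel
  map_smul' a X := by
    simp only [lamMap_eq, tracelessPart_smul, Matrix.smul_mul, Matrix.trace_smul, smul_eq_mul,
      RingHom.id_apply, smul_sub, Finset.smul_sum, smul_smul, mul_div_assoc]
    congr 1
    refine Finset.sum_congr rfl fun α _ => Finset.sum_congr rfl fun g _ =>
      Finset.sum_congr rfl fun l _ => ?_
    congr 1
    ring

lemma conjTranspose_lamMap {d N M : ℕ} {E : Fin N → Fin M → Matrix (Fin d) (Fin d) ℂ}
    (hE : ∀ α l, (E α l).IsHermitian) (O : Fin N → Matrix (Fin M) (Fin M) ℝ) (h : ℝ)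
    (X : Matrix (Fin d) (Fin d) ℂ) : (LamMap E O h X)ᴴ = LamMap E O h Xᴴ := by
  have ht : ∀ α l, star (tracelessPart X * E α l).trace =
      (tracelessPart Xᴴ * E α l).trace := by
    intro α l
    rw [← Matrix.trace_conjTranspose, Matrix.conjTranspose_mul, (hE α l).eq,
      Matrix.trace_mul_comm, conjTranspose_tracelessPart]
  simp only [lamMap_eq, Matrix.conjTranspose_sub, Matrix.conjTranspose_smul, ht,
    Matrix.conjTranspose_sum, (hE _ _).eq, Matrix.conjTranspose_one]
  simp [Matrix.trace_conjTranspose]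

lemma isHermitian_idTensor_proj {d : ℕ}
    {Λ : Matrix (Fin d) (Fin d) ℂ → Matrix (Fin d) (Fin d) ℂ} (hΛ : ∀ X, (Λ X)ᴴ = Λ Xᴴ)
    (ψ : Fin d × Fin d → ℂ) : (idTensor Λ (proj ψ)).IsHermitian := by
  ext p q
  simp only [idTensor, Matrix.conjTranspose_apply, Matrix.of_apply]
  rw [← Matrix.conjTranspose_apply, hΛ]
  congr 2
  ext a b
  simp [proj, Matrix.vecMulVec_apply, mul_comm]

/-- The quadratic form of `(id ⊗ Λ)(|ψ⟩⟨ψ|)` for a vector `ψ = ∑ m, u m ⊗ v m`. -/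
lemma star_dotProduct_idTensor_proj_mulVec {d : ℕ} {ι : Type*} [Fintype ι]
    (Λ : Matrix (Fin d) (Fin d) ℂ →ₗ[ℂ] Matrix (Fin d) (Fin d) ℂ)
    {ψ : Fin d × Fin d → ℂ} {u v : ι → Fin d → ℂ} (hψ : ∀ p, ψ p = ∑ m, u m p.1 * v m p.2)
    (φ : Fin d × Fin d → ℂ) :
    star φ ⬝ᵥ idTensor Λ (proj ψ) *ᵥ φ =
      ∑ m, ∑ n, star (fun a => ∑ i, star (u m i) * φ (i, a)) ⬝ᵥ
        Λ (Matrix.vecMulVec (v m) (star (v n))) *ᵥ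
          (fun a => ∑ i, star (u n i) * φ (i, a)) := by
  have hblock : ∀ i j, Λ (Matrix.of fun a b => proj ψ (i, a) (j, b)) =
      ∑ m, ∑ n, (u m i * star (u n j)) • Λ (Matrix.vecMulVec (v m) (star (v n))) := by
    intro i j
    simp only [← map_smul, ← map_sum]
    congr 1
    ext a b
    simp only [proj, Matrix.vecMulVec_apply, Matrix.of_apply, Pi.star_apply, hψ, star_sum,
      star_mul', Finset.sum_mul_sum, Matrix.sum_apply, Matrix.smul_apply, smul_eq_mul]
    refine Finset.sum_congr rfl fun m _ => Finset.sum_congr rfl fun n _ => ?_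
    ring
  have hL : star φ ⬝ᵥ idTensor Λ (proj ψ) *ᵥ φ = ∑ i, ∑ a, ∑ j, ∑ b, ∑ m, ∑ n,
      star (φ (i, a)) * (u m i * star (u n j)) *
        Λ (Matrix.vecMulVec (v m) (star (v n))) a b * φ (j, b) := by
    simp only [dotProduct, Matrix.mulVec, Fintype.sum_prod_type, idTensor, Matrix.of_apply,
      hblock, Matrix.sum_apply, Matrix.smul_apply, smul_eq_mul, Finset.mul_sum, Finset.sum_mul,
      Pi.star_apply, mul_assoc]
  have hR : ∀ m n, star (fun a => ∑ i, star (u m i) * φ (i, a)) ⬝ᵥ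
        Λ (Matrix.vecMulVec (v m) (star (v n))) *ᵥ
          (fun a => ∑ i, star (u n i) * φ (i, a)) = ∑ i, ∑ a, ∑ j, ∑ b,
      star (φ (i, a)) * (u m i * star (u n j)) *
        Λ (Matrix.vecMulVec (v m) (star (v n))) a b * φ (j, b) := by
    intro m n
    rw [Finset.sum_comm, dotProduct]
    refine Finset.sum_congr rfl fun a _ => ?_
    rw [Pi.star_apply, star_sum, Finset.sum_mul]
    refine Finset.sum_congr rfl fun i _ => ?_
    rw [Finset.sum_comm, Matrix.mulVec, dotProduct, Finset.mul_sum]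
    refine Finset.sum_congr rfl fun b _ => ?_
    rw [Finset.mul_sum, Finset.mul_sum]
    refine Finset.sum_congr rfl fun j _ => ?_
    rw [star_mul', star_star]
    ring
  rw [hL]
  simp only [hR]
  have hcomm := Finset.sum_comm (s := (Finset.univ : Finset (Fin d × Fin d × Fin d × Fin d)))
    (t := (Finset.univ : Finset (ι × ι))) (f := fun p q =>
      star (φ (p.1, p.2.1)) * (u q.1 p.1 * star (u q.2 p.2.2.1)) *
        Λ (Matrix.vecMulVec (v q.1) (star (v q.2))) p.2.1 p.2.2.2 * φ (p.2.2.1, p.2.2.2))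
  simpa only [Fintype.sum_prod_type] using hcomm

lemma psiK_apply {d k : ℕ} (hkd : k ≤ d) (U V : Matrix (Fin d) (Fin d) ℂ) (p : Fin d × Fin d) :
    psiK d k U V p = ∑ m : Fin k, ((1 / Real.sqrt k : ℝ) * U p.1 (Fin.castLE hkd m)) *
      V p.2 (Fin.castLE hkd m) := by
  have hL : psiK d k U V p = ∑ i : Fin d, if (i : ℕ) < k then
      ((1 / Real.sqrt k : ℝ) * U p.1 i) * V p.2 i else 0 := by
    simp only [psiK, Matrix.mulVec, dotProduct, Fintype.sum_prod_type,
      Matrix.kroneckerMap_apply, ite_and, mul_ite, mul_zero, Finset.sum_ite_eq, Finset.mem_univ,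
      if_true]
    refine Finset.sum_congr rfl fun i _ => ?_
    split_ifs <;> ring
  rw [hL]
  symm
  refine Finset.sum_of_injOn (Fin.castLE hkd) (Fin.castLE_injective hkd).injOn (by simp) ?_ ?_
  · intro i _ hi
    refine if_neg fun hik => hi ⟨⟨i, hik⟩, by simp, by ext; simp⟩
  · intro m _
    simp

/-- the map Λ associated to an informationally complete (N,M)-POVM
is k-positive. -/
theorem povm_map_k_positive (d N M k : ℕ) (hd : 2 ≤ d) (hN : 2 ≤ N) (hM : 2 ≤ M)
    (hdim : N * (M - 1) = d ^ 2 - 1) (x : ℝ)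
    (E : Fin N → Fin M → Matrix (Fin d) (Fin d) ℂ) (hE : IsICPOVM d N M x E)
    (O : Fin N → Matrix (Fin M) (Fin M) ℝ)
    (hO : ∀ α, (O α)ᵀ * O α = 1)
    (hOnes : ∀ α, (O α).mulVec (fun _ => 1) = fun _ => 1)
    (hk1 : 1 ≤ k) (hkd : k ≤ d) :
    ∀ U V : Matrix (Fin d) (Fin d) ℂ,
      U ∈ Matrix.unitaryGroup (Fin d) ℂ → V ∈ Matrix.unitaryGroup (Fin d) ℂ →
      (idTensor (LamMap E O (hx d M k x)) (proj (psiK d k U V))).PosSemidef := by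
  intro U V _ hV
  have hherm := isHermitian_idTensor_proj
    (conjTranspose_lamMap (fun α l => (hE.1 α l).isHermitian) O (hx d M k x)) (psiK d k U V)
  refine Matrix.PosSemidef.of_dotProduct_mulVec_nonneg hherm fun φ => ?_
  rw [Complex.le_def]
  refine ⟨?_, (hherm.im_star_dotProduct_mulVec_self φ).symm⟩
  have hv : ∀ m n : Fin k, star (fun a => V a (Fin.castLE hkd m)) ⬝ᵥ
      (fun a => V a (Fin.castLE hkd n)) = if m = n then 1 else 0 := by
    intro m n
    have := congrFun (congrFun (Matrix.mem_unitaryGroup_iff'.1 hV) (Fin.castLE hkd m))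
      (Fin.castLE hkd n)
    simpa [Matrix.mul_apply, dotProduct, Matrix.one_apply] using this
  have hquad := star_dotProduct_idTensor_proj_mulVec (lamMapLinear E O (hx d M k x))
    (u := fun m i => (1 / Real.sqrt k : ℝ) * U i (Fin.castLE hkd m))
    (v := fun m a => V a (Fin.castLE hkd m)) (psiK_apply hkd U V) φ
  exact (hE.sum_lamMap_re_nonneg hd hM hk1 hO hOnes hv _).trans_eq (congrArg Complex.re hquad).symm
end
end

section
/- Let d ≥ 2 and let X be a Hermitian d×d complex matrix with Tr(X) = 1 and Tr(X²) ≤ 1/(d−1). Then X is positive semidefinite. -/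
open Matrix
open scoped ComplexOrder

/-- The trace of the square of a Hermitian matrix is the sum of the squares of its eigenvalues. -/
theorem Matrix.IsHermitian.trace_mul_self_eq_sum_eigenvalues_sq {𝕜 n : Type*} [RCLike 𝕜]
    [Fintype n] [DecidableEq n] {A : Matrix n n 𝕜} (hA : A.IsHermitian) :
    (A * A).trace = ∑ i, (hA.eigenvalues i : 𝕜) ^ 2 := by
  conv_lhs =>
    rw [hA.spectral_theorem, ← map_mul, Unitary.conjStarAlgAut_apply, trace_mul_cycle,
      Unitary.coe_star_mul_self, one_mul, diagonal_mul_diagonal, trace_diagonal]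
  simp [pow_two]

/-- Real numbers with sum `1` whose squares sum to at most `1 / (#ι - 1)` are nonnegative. -/
theorem nonneg_of_sum_eq_one_of_sum_sq_le {ι : Type*} [Fintype ι] [DecidableEq ι] {f : ι → ℝ}
    (hι : 2 ≤ Fintype.card ι) (hsum : ∑ i, f i = 1)
    (hsq : ∑ i, f i ^ 2 ≤ 1 / ((Fintype.card ι : ℝ) - 1)) (i : ι) : 0 ≤ f i := by
  have hcard : (2 : ℝ) ≤ Fintype.card ι := by exact_mod_cast hι
  have hcs := sq_sum_le_card_mul_sum_sq (s := Finset.univ.erase i) (f := f)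
  rw [Finset.card_erase_of_mem (Finset.mem_univ i), Finset.card_univ,
    Nat.cast_sub (by lia), Nat.cast_one] at hcs
  rw [← Finset.add_sum_erase _ _ (Finset.mem_univ i)] at hsum hsq
  rw [le_div_iff₀ (by linarith)] at hsq
  rw [← eq_sub_iff_add_eq'] at hsum
  rw [hsum] at hcs
  by_contra! hneg
  nlinarith [mul_nonneg (by linarith : (0 : ℝ) ≤ Fintype.card ι) (sq_nonneg (f i))]

/-- a Hermitian matrix of trace 1 with Tr(X²) ≤ 1/(d−1) is
positive semidefinite. -/
theorem hermitian_trace_sq_le_posSemidef (d : ℕ) (hd : 2 ≤ d)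
    (X : Matrix (Fin d) (Fin d) ℂ) (hX : X.IsHermitian) (htr : X.trace = 1)
    (h2 : (X * X).trace ≤ ((1 / ((d : ℝ) - 1) : ℝ) : ℂ)) :
    X.PosSemidef := by
  rw [hX.posSemidef_iff_eigenvalues_nonneg]
  have hsum : ∑ i, Complex.ofReal (hX.eigenvalues i) = 1 :=
    hX.trace_eq_sum_eigenvalues.symm.trans htr
  have hsq : ∑ i, Complex.ofReal (hX.eigenvalues i) ^ 2 ≤ ((1 / ((d : ℝ) - 1) : ℝ) : ℂ) :=
    hX.trace_mul_self_eq_sum_eigenvalues_sq.symm.trans_le h2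
  refine nonneg_of_sum_eq_one_of_sum_sq_le (by simpa using hd) (by exact_mod_cast hsum) ?_
  rw [Fintype.card_fin, ← Complex.real_le_real]
  simpa only [Complex.ofReal_sum, Complex.ofReal_pow] using hsq
end

section
/- Let d ≥ 2, N, M ≥ 2 be integers with N(M−1) = d²−1 and let {E_{α,k}} be an informationally complete (N,M)-POVM on ℂ^d with parameter x. Then for every d×d complex matrix σ, ∑_{α=1}^{N}∑_{k=1}^{M} |Tr(E_{α,k}σ)|² = [d(M²x−d)·Tr(σσ†) + (d³−M²x)·|Tr(σ)|²] / (dM(M−1)), where σ† is the conjugate transpose of σ. -/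
open Matrix Kronecker
open scoped ComplexOrder

noncomputable section

/-- An idempotent endomorphism whose trace is the dimension of the space is the identity. -/
theorem LinearMap.eq_id_of_isIdempotentElem_of_trace_eq_finrank {V : Type*} [AddCommGroup V]
    [Module ℂ V] [FiniteDimensional ℂ V] {p : V →ₗ[ℂ] V} (hp : IsIdempotentElem p)
    (ht : LinearMap.trace ℂ V p = Module.finrank ℂ V) : p = LinearMap.id := by
  have h := (LinearMap.IsIdempotentElem.isProj_range p hp).trace
  rw [ht, Nat.cast_inj] at h
  have hr : LinearMap.range p = ⊤ := Submodule.eq_top_of_finrank_eq h.symm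
  ext v
  obtain ⟨w, rfl⟩ := LinearMap.range_eq_top.mp hr v
  exact LinearMap.congr_fun hp w

/-- A linear reconstruction formula: a frame operator fixing all its vectors, whose trace
is the dimension, is the identity. -/
theorem sum_smul_eq_self_of_trace_eq_finrank {V ι : Type*} [Fintype ι] [AddCommGroup V]
    [Module ℂ V] [FiniteDimensional ℂ V] (f : ι → V →ₗ[ℂ] ℂ) (v : ι → V)
    (hfix : ∀ j, ∑ i, f i (v j) • v i = v j)
    (ht : ∑ i, f i (v i) = Module.finrank ℂ V) (w : V) : ∑ i, f i w • v i = w := by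
  set p : V →ₗ[ℂ] V := ∑ i, (f i).smulRight (v i) with hp
  have hpa (u : V) : p u = ∑ i, f i u • v i := by simp [hp, LinearMap.sum_apply]
  have hid : IsIdempotentElem p := by
    ext u
    rw [Module.End.mul_apply, hpa u, map_sum]
    refine Finset.sum_congr rfl fun i _ => ?_
    rw [map_smul, hpa, hfix]
  have htr : LinearMap.trace ℂ V p = Module.finrank ℂ V := by
    simp [hp, map_sum, ← ht, LinearMap.trace_smulRight]
  rw [← hpa, LinearMap.eq_id_of_isIdempotentElem_of_trace_eq_finrank hid htr, LinearMap.id_apply]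

/-- Reconstruction of a matrix from a family of traceless matrices with the Gram matrix of `N`
mutually orthogonal regular simplices. -/
theorem sum_trace_smul_eq_of_simplices {d N M : ℕ} (hd : d ≠ 0) (hM : M ≠ 0)
    (hdim : (N : ℂ) * (M - 1) = (d : ℂ) ^ 2 - 1) {a : ℂ} (ha : a ≠ 0)
    (F : Fin N → Fin M → Matrix (Fin d) (Fin d) ℂ)
    (hsum : ∀ α, ∑ k, F α k = 0) (htr : ∀ α k, (F α k).trace = 0)
    (hsame : ∀ α k l, (F α k * F α l).trace = a * ((if k = l then 1 else 0) - 1 / M))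
    (hdiff : ∀ α β k l, α ≠ β → (F α k * F β l).trace = 0)
    (σ : Matrix (Fin d) (Fin d) ℂ) :
    ∑ α, ∑ k, (F α k * σ).trace • F α k = a • (σ - (σ.trace / d) • 1) := by
  have hd' : (d : ℂ) ≠ 0 := Nat.cast_ne_zero.mpr hd
  have hM' : (M : ℂ) ≠ 0 := Nat.cast_ne_zero.mpr hM
  let f : Option (Fin N × Fin M) → Matrix (Fin d) (Fin d) ℂ →ₗ[ℂ] ℂ := fun i =>
    i.elim ((d : ℂ)⁻¹ • Matrix.traceLinearMap (Fin d) ℂ ℂ) fun q =>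
      a⁻¹ • (Matrix.traceLinearMap (Fin d) ℂ ℂ ∘ₗ LinearMap.mulLeft ℂ (F q.1 q.2))
  let v : Option (Fin N × Fin M) → Matrix (Fin d) (Fin d) ℂ := fun i =>
    i.elim 1 fun q => F q.1 q.2
  have hexp (w : Matrix (Fin d) (Fin d) ℂ) : ∑ i, f i w • v i =
      (w.trace / d) • 1 + a⁻¹ • ∑ α, ∑ k, (F α k * w).trace • F α k := by
    simp [f, v, Fintype.sum_option, Fintype.sum_prod_type, Finset.smul_sum, smul_smul,
      div_eq_inv_mul]
  have hfix (j) : ∑ i, f i (v j) • v i = v j := by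
    rw [hexp]
    rcases j with _ | ⟨β, l⟩
    · simp [v, htr, hd']
    · have hzero : ∀ α, α ≠ β → ∑ k, (F α k * F β l).trace • F α k = 0 := fun α h =>
        Finset.sum_eq_zero fun k _ => by rw [hdiff α β k l h, zero_smul]
      have hβ : ∑ k, (F β k * F β l).trace • F β k = a • F β l := by
        simp_rw [hsame, mul_smul, sub_smul]
        rw [← Finset.smul_sum, Finset.sum_sub_distrib, ← Finset.smul_sum, hsum]
        simp
      simp only [v, Option.elim]
      rw [Fintype.sum_eq_single β hzero, hβ, htr, smul_smul, inv_mul_cancel₀ ha]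
      simp
  have htrace : ∑ i, f i (v i) = Module.finrank ℂ (Matrix (Fin d) (Fin d) ℂ) := by
    simp only [f, v, Fintype.sum_option, Option.elim, LinearMap.smul_apply,
      LinearMap.comp_apply, LinearMap.mulLeft_apply, Matrix.traceLinearMap_apply, hsame,
      Matrix.trace_one, smul_eq_mul, inv_mul_cancel_left₀ ha, Module.finrank_matrix,
      Fintype.card_fin, Fintype.card_prod, Module.finrank_self, Finset.sum_const, Finset.card_univ,
      nsmul_eq_mul, inv_mul_cancel₀ hd', if_true]
    push_cast
    field_simp
    linear_combination hdim
  have h := sum_smul_eq_self_of_trace_eq_finrank f v hfix htrace σ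
  rw [hexp] at h
  rw [← eq_sub_iff_add_eq'] at h
  rw [← h, smul_smul, mul_inv_cancel₀ ha, one_smul]

/-- the index-of-coincidence identity for informationally complete
(N,M)-POVMs: ∑ |Tr(E_{α,k}σ)|² in terms of Tr(σσ†) and |Tr σ|². -/
theorem povm_trace_sum_identity (d N M : ℕ) (hd : 2 ≤ d) (hN : 2 ≤ N) (hM : 2 ≤ M)
    (hdim : N * (M - 1) = d ^ 2 - 1) (x : ℝ)
    (E : Fin N → Fin M → Matrix (Fin d) (Fin d) ℂ) (hE : IsICPOVM d N M x E)
    (σ : Matrix (Fin d) (Fin d) ℂ) :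
    ∑ α, ∑ k, (E α k * σ).trace * star ((E α k * σ).trace) =
      ((d : ℂ) * ((M : ℂ) ^ 2 * x - d) * (σ * σᴴ).trace +
        ((d : ℂ) ^ 3 - (M : ℂ) ^ 2 * x) * (σ.trace * star σ.trace)) /
        ((d : ℂ) * M * ((M : ℂ) - 1)) := by
  obtain ⟨hpos, hone, htr, hsq, hsame, hdiff, hxlo, -⟩ := hE
  have hd0 : (d : ℂ) ≠ 0 := Nat.cast_ne_zero.mpr (by omega)
  have hM0 : (M : ℂ) ≠ 0 := Nat.cast_ne_zero.mpr (by omega)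
  have hM1 : (M : ℂ) - 1 ≠ 0 := sub_ne_zero.mpr (by exact_mod_cast (by omega : M ≠ 1))
  have hdimC : (N : ℂ) * (M - 1) = (d : ℂ) ^ 2 - 1 := by
    have h := congrArg (Nat.cast : ℕ → ℂ) hdim
    rwa [Nat.cast_mul, Nat.cast_sub (by omega), Nat.cast_sub (Nat.one_le_pow _ _ (by omega)),
      Nat.cast_pow, Nat.cast_one] at h
  have hgap : (M : ℂ) ^ 2 * x - d ≠ 0 := by
    have hMpos : (0 : ℝ) < (M : ℝ) ^ 2 := by positivity
    rw [div_lt_iff₀ hMpos] at hxlo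
    have h : (M : ℝ) ^ 2 * x - d ≠ 0 := by linarith
    exact_mod_cast h
  set a : ℂ := ((M : ℂ) ^ 2 * x - d) / (M * (M - 1)) with ha
  have ha0 : a ≠ 0 := div_ne_zero hgap (mul_ne_zero hM0 hM1)
  let F : Fin N → Fin M → Matrix (Fin d) (Fin d) ℂ := fun α k => E α k - (M : ℂ)⁻¹ • 1
  have hFmul (α β k l) : (F α k * F β l).trace = (E α k * E β l).trace - d / (M : ℂ) ^ 2 := by
    simp only [F, sub_mul, mul_sub, smul_mul_assoc, mul_smul_comm, one_mul, mul_one,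
      Matrix.trace_sub, Matrix.trace_smul, htr, Matrix.trace_one, Fintype.card_fin, smul_eq_mul]
    field_simp
    ring
  have hFsum (α) : ∑ k, F α k = 0 := by
    simp [F, Finset.sum_sub_distrib, hone, ← Nat.cast_smul_eq_nsmul ℂ, smul_smul, hM0]
  have hFtr (α k) : (F α k).trace = 0 := by
    simp [F, htr]
    field_simp
    ring
  have hFsame (α k l) : (F α k * F α l).trace = a * ((if k = l then 1 else 0) - 1 / M) := by
    rw [hFmul, ha]
    split_ifs with h
    · subst h
      rw [hsq]
      field_simp
    · rw [hsame α k l h]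
      field_simp
      ring
  have hFdiff (α β k l) (h : α ≠ β) : (F α k * F β l).trace = 0 := by
    rw [hFmul, hdiff α β k l h, sub_self]
  have hrec := sum_trace_smul_eq_of_simplices (by omega) (by omega) hdimC ha0 F hFsum hFtr
    hFsame hFdiff σ
  have hFF : ∑ α, ∑ k, (F α k * σ).trace * (F α k * σᴴ).trace =
      a * ((σ * σᴴ).trace - σ.trace * star σ.trace / d) := by
    have h := congrArg (fun X => (X * σᴴ).trace) hrec
    simp only [Finset.sum_mul, Matrix.trace_sum, smul_mul_assoc, Matrix.trace_smul, smul_eq_mul,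
      sub_mul, one_mul, Matrix.trace_sub, Matrix.trace_conjTranspose] at h
    rw [h]
    ring
  have hFtrace (α k) (X : Matrix (Fin d) (Fin d) ℂ) :
      (E α k * X).trace = (F α k * X).trace + X.trace / M := by
    simp [F, sub_mul, div_eq_inv_mul]
  have hstar (α k) : star (E α k * σ).trace = (E α k * σᴴ).trace := by
    rw [← Matrix.trace_conjTranspose, Matrix.conjTranspose_mul, (hpos α k).isHermitian.eq,
      Matrix.trace_mul_comm]
  have hFzero (α) (X : Matrix (Fin d) (Fin d) ℂ) : ∑ k, (F α k * X).trace = 0 := by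
    rw [← Matrix.trace_sum, ← Finset.sum_mul, hFsum, zero_mul, Matrix.trace_zero]
  have hE_sum : ∑ α, ∑ k, (E α k * σ).trace * star ((E α k * σ).trace) =
      ∑ α, ∑ k, (F α k * σ).trace * (F α k * σᴴ).trace
        + N * (σ.trace * star σ.trace / M) := by
    simp_rw [hstar, hFtrace, add_mul, mul_add, Finset.sum_add_distrib, ← Finset.mul_sum,
      ← Finset.sum_mul, hFzero]
    simp [Matrix.trace_conjTranspose]
    field_simp
  rw [hE_sum, hFF, ha]
  field_simp
  linear_combination (d : ℂ) * (σ.trace * star σ.trace) * hdimC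
end
end

section
/- Let d ≥ 2, let 1 ≤ k ≤ d, and let Λ be a linear map on d×d complex matrices such that (id ⊗ Λ)(|ψ_k⟩⟨ψ_k|) is positive semidefinite for every maximally entangled state of Schmidt rank k, i.e., for every |ψ_k⟩ = (U⊗V)·(1/√k)·∑_{i=0}^{k−1}|i⟩⊗|i⟩ with U, V unitary d×d matrices. Then (id ⊗ Λ)(|φ⟩⟨φ|) is positive semidefinite for every unit vector φ ∈ ℂ^d ⊗ ℂ^d of Schmidt rank at most k; consequently (id ⊗ Λ)(ρ) is positive semidefinite for every density matrix ρ of Schmidt number at most k. -/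
open Matrix Kronecker
open scoped ComplexOrder

noncomputable section

/-- The slice `(i, ·), (j, ·)` of a bipartite matrix. -/
def slice {d : ℕ} (ρ : Matrix (Fin d × Fin d) (Fin d × Fin d) ℂ) (i j : Fin d) :
    Matrix (Fin d) (Fin d) ℂ :=
  Matrix.of fun a b => ρ (i, a) (j, b)

/-- `id ⊗ Λ` commutes with conjugation by a local operator `W ⊗ 1` on the first factor. -/
lemma idTensor_proj_kronecker_one {d : ℕ}
    (Λ : Matrix (Fin d) (Fin d) ℂ →ₗ[ℂ] Matrix (Fin d) (Fin d) ℂ)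
    (W : Matrix (Fin d) (Fin d) ℂ) (φ ψ : Fin d × Fin d → ℂ)
    (h : ∀ a c, φ (a, c) = ∑ j, W a j * ψ (j, c)) :
    idTensor Λ (proj φ) = (W ⊗ₖ 1) * idTensor Λ (proj ψ) * (W ⊗ₖ 1)ᴴ := by
  have hs : ∀ i l, slice (proj φ) i l =
      ∑ m, ∑ j, (W i j * star (W l m)) • slice (proj ψ) j m := by
    intro i l
    ext a b
    simp only [slice, proj, Matrix.of_apply, Matrix.vecMulVec_apply, Pi.star_apply, h,
      Matrix.sum_apply, Matrix.smul_apply, star_sum, star_mul', Finset.sum_mul_sum, smul_eq_mul]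
    rw [Finset.sum_comm]
    exact Finset.sum_congr rfl fun _ _ => Finset.sum_congr rfl fun _ _ => by ring
  ext ⟨i, a⟩ ⟨l, b⟩
  change Λ (slice (proj φ) i l) a b = _
  rw [hs]
  simp only [map_sum, map_smul, Matrix.sum_apply, Matrix.smul_apply, Matrix.mul_apply,
    Fintype.sum_prod_type, Matrix.conjTranspose_apply, Matrix.kroneckerMap_apply,
    Matrix.one_apply, mul_ite, ite_mul, mul_one, mul_zero, zero_mul, apply_ite star, star_zero,
    Finset.sum_ite_eq, Finset.mem_univ, if_true, Finset.sum_mul, smul_eq_mul]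
  refine Finset.sum_congr rfl fun m _ => Finset.sum_congr rfl fun j _ => ?_
  change _ = W i j * Λ (slice (proj ψ) j m) a b * star (W l m)
  ring

/-- A square matrix of rank at most `k` admits an orthonormal basis whose members of index at
least `k` lie in its kernel. -/
lemma exists_orthonormalBasis_mulVec_eq_zero {d k : ℕ} (A : Matrix (Fin d) (Fin d) ℂ)
    (hA : A.rank ≤ k) :
    ∃ b : OrthonormalBasis (Fin d) ℂ (EuclideanSpace ℂ (Fin d)),
      ∀ j : Fin d, k ≤ (j : ℕ) → ∀ a, ∑ c, A a c * b j c = 0 := by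
  set K := LinearMap.ker (Matrix.toEuclideanLin A) with hK
  have hdim : d ≤ k + Module.finrank ℂ K := by
    have h1 := LinearMap.finrank_range_add_finrank_ker (Matrix.toEuclideanLin A)
    have h2 : Module.finrank ℂ (LinearMap.range (Matrix.toEuclideanLin A)) = A.rank :=
      (Matrix.rank_eq_finrank_range_toLin A (PiLp.basisFun 2 ℂ (Fin d))
        (PiLp.basisFun 2 ℂ (Fin d))).symm
    rw [finrank_euclideanSpace_fin, h2, ← hK] at h1
    omega
  let e := stdOrthonormalBasis ℂ K
  let v : Fin d → EuclideanSpace ℂ (Fin d) := fun i =>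
    if h : k ≤ (i : ℕ) then (e ⟨i - k, by omega⟩ : EuclideanSpace ℂ (Fin d)) else 0
  have hv : ∀ (i : Fin d) (h : k ≤ (i : ℕ)),
      v i = (e ⟨i - k, by omega⟩ : EuclideanSpace ℂ (Fin d)) := fun i h => dif_pos h
  have hon : Orthonormal ℂ (({i | k ≤ (i : ℕ)} : Set (Fin d)).domRestrict v) := by
    have he := (e.orthonormal.comp_linearIsometry K.subtypeₗᵢ).comp
      (fun i : ({i | k ≤ (i : ℕ)} : Set (Fin d)) =>
        (⟨(i : Fin d) - k, by have := i.1.2; have : k ≤ (i.1 : ℕ) := i.2; omega⟩ : Fin (Module.finrank ℂ K)))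
      (by
        rintro ⟨i, hi⟩ ⟨j, hj⟩ hij
        simp only [Set.mem_ofPred_eq, Fin.mk.injEq] at hi hj hij
        exact Subtype.ext (Fin.ext (show (i : ℕ) = j by omega)))
    convert he using 1
    ext1 i
    exact hv i.1 i.2
  obtain ⟨b, hb⟩ := hon.exists_orthonormalBasis_extension_of_card_eq (by simp)
  refine ⟨b, fun j hj a => ?_⟩
  have hmem : b j ∈ K := by
    rw [hb j hj, hv j hj]
    exact Subtype.property _
  have := congrArg (fun x : EuclideanSpace ℂ (Fin d) => x a) (LinearMap.mem_ker.mp hmem)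
  simpa [Matrix.toLpLin_apply, Matrix.mulVec, dotProduct] using this

/-- A vector of Schmidt rank at most `k` is the image of a maximally entangled vector of Schmidt
rank `k` under a local operator on the first factor. -/
lemma exists_eq_sum_mul_psiK {d k : ℕ} (hk : 1 ≤ k) (φ : Fin d × Fin d → ℂ)
    (hφ : (Matrix.of fun a b => φ (a, b)).rank ≤ k) :
    ∃ V ∈ Matrix.unitaryGroup (Fin d) ℂ, ∃ W : Matrix (Fin d) (Fin d) ℂ,
      ∀ a c, φ (a, c) = ∑ j, W a j * psiK d k 1 V (j, c) := by
  obtain ⟨b, hb⟩ := exists_orthonormalBasis_mulVec_eq_zero _ hφ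
  simp only [Matrix.of_apply] at hb
  let V : Matrix (Fin d) (Fin d) ℂ := Matrix.of fun c j => star (b j c)
  have hV : V ∈ Matrix.unitaryGroup (Fin d) ℂ := by
    rw [Matrix.mem_unitaryGroup_iff']
    ext i j
    have := orthonormal_iff_ite.mp b.orthonormal j i
    rw [PiLp.inner_apply] at this
    simpa [V, Matrix.mul_apply, Matrix.star_apply, Matrix.one_apply, eq_comm, mul_comm] using this
  refine ⟨V, hV, Matrix.of fun a j => (Real.sqrt k : ℂ) * ∑ c, φ (a, c) * b j c, fun a c => ?_⟩
  have hpsi : ∀ j, psiK d k 1 V (j, c) =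
      if (j : ℕ) < k then V c j * (((1 : ℝ) / Real.sqrt k : ℝ) : ℂ) else 0 := by
    intro j
    simp [psiK, Matrix.mulVec, dotProduct, Fintype.sum_prod_type, Matrix.one_apply, ite_and]
    rw [Finset.sum_eq_single j] <;> simp +contextual [eq_comm]
  have hsqrt : (Real.sqrt k : ℂ) ≠ 0 := by
    have : (0 : ℝ) < k := by exact_mod_cast hk
    exact_mod_cast (Real.sqrt_pos.mpr this).ne'
  have hterm : ∀ j, (Matrix.of fun a j => (Real.sqrt k : ℂ) * ∑ c, φ (a, c) * b j c) a j *
      psiK d k 1 V (j, c) = ∑ x, φ (a, x) * (V c j * star (V x j)) := by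
    intro j
    have hsum : ∑ x, φ (a, x) * (V c j * star (V x j)) = V c j * ∑ x, φ (a, x) * b j x := by
      rw [Finset.mul_sum]
      exact Finset.sum_congr rfl fun x _ => by simp only [V, Matrix.of_apply, star_star]; ring
    rw [hsum, hpsi, Matrix.of_apply]
    split_ifs with hj
    · push_cast
      field_simp
    · rw [hb j (not_lt.mp hj) a]
      simp
  have hone : ∀ x, ∑ j, V c j * star (V x j) = if c = x then 1 else 0 := by
    intro x
    have := congrFun (congrFun (Matrix.mem_unitaryGroup_iff.mp hV) c) x
    simpa only [Matrix.mul_apply, Matrix.star_apply, Matrix.one_apply] using this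
  rw [Finset.sum_congr rfl fun j _ => hterm j, Finset.sum_comm]
  simp only [← Finset.mul_sum, hone]
  simp

/-- `id ⊗ Λ` commutes with finite linear combinations. -/
lemma idTensor_sum_smul {d : ℕ} {ι : Type*} (s : Finset ι)
    (Λ : Matrix (Fin d) (Fin d) ℂ →ₗ[ℂ] Matrix (Fin d) (Fin d) ℂ) (c : ι → ℂ)
    (ρ : ι → Matrix (Fin d × Fin d) (Fin d × Fin d) ℂ) :
    idTensor Λ (∑ i ∈ s, c i • ρ i) = ∑ i ∈ s, c i • idTensor Λ (ρ i) := by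
  have hs : ∀ p q, slice (∑ i ∈ s, c i • ρ i) p q = ∑ i ∈ s, c i • slice (ρ i) p q := by
    intro p q
    ext a b
    simp [slice, Matrix.sum_apply]
  ext p q
  change Λ (slice (∑ i ∈ s, c i • ρ i) p.1 q.1) p.2 q.2 = _
  rw [hs]
  simp only [map_sum, map_smul, Matrix.sum_apply, Matrix.smul_apply]
  rfl

/-- if (id ⊗ Λ) is positive on all maximally entangled states of
Schmidt rank k, then it is positive on all pure states of Schmidt rank at most k,
and hence on all states of Schmidt number at most k. -/
theorem k_positive_on_schmidt_rank_le (d k : ℕ) (hd : 2 ≤ d) (hk1 : 1 ≤ k) (hkd : k ≤ d)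
    (Λ : Matrix (Fin d) (Fin d) ℂ →ₗ[ℂ] Matrix (Fin d) (Fin d) ℂ)
    (hΛ : ∀ U V : Matrix (Fin d) (Fin d) ℂ,
      U ∈ Matrix.unitaryGroup (Fin d) ℂ → V ∈ Matrix.unitaryGroup (Fin d) ℂ →
      (idTensor (⇑Λ) (proj (psiK d k U V))).PosSemidef) :
    (∀ φ : Fin d × Fin d → ℂ, (∑ q, ‖φ q‖ ^ 2 = 1) →
      (Matrix.of fun a b => φ (a, b)).rank ≤ k →
      (idTensor (⇑Λ) (proj φ)).PosSemidef) ∧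
    (∀ ρ : Matrix (Fin d × Fin d) (Fin d × Fin d) ℂ,
      ρ.PosSemidef → ρ.trace = 1 → SchmidtNumberLE d k ρ →
      (idTensor (⇑Λ) ρ).PosSemidef) := by
  have hpure : ∀ φ : Fin d × Fin d → ℂ, (Matrix.of fun a b => φ (a, b)).rank ≤ k →
      (idTensor (⇑Λ) (proj φ)).PosSemidef := by
    intro φ hφ
    obtain ⟨V, hV, W, hW⟩ := exists_eq_sum_mul_psiK hk1 φ hφ
    rw [idTensor_proj_kronecker_one Λ W φ _ hW]
    exact (hΛ 1 V (one_mem _) hV).mul_mul_conjTranspose_same _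
  refine ⟨fun φ _ hφ => hpure φ hφ, ?_⟩
  rintro ρ - - ⟨n, p, ψ, hp, -, -, hψ, rfl⟩
  rw [idTensor_sum_smul]
  exact Matrix.posSemidef_sum _ fun i _ =>
    (hpure _ (hψ i)).smul (by exact_mod_cast hp i)
end
end

section
/- Let d ≥ 2, N, M ≥ 2 be integers with N(M−1) = d²−1, and let {G_{α,k} : α = 1,…,N; k = 1,…,M−1} be traceless Hermitian d×d matrices such that the family {I_d/√d} ∪ {G_{α,k}} is orthonormal with respect to the Hilbert–Schmidt inner product. For each α set G_α = ∑_{k=1}^{M−1} G_{α,k}, define H_{α,k} = G_α − √M(√M+1)·G_{α,k} for k = 1,…,M−1 and H_{α,M} = (√M+1)·G_α, and for a real parameter t define E_{α,k} = I_d/M + t·H_{α,k}. Then, with x = d/M² + t²(M−1)(√M+1)², the following hold: (i) ∑_{k=1}^{M} E_{α,k} = I_d for each α; (ii) Tr(E_{α,k}) = d/M for all α, k; (iii) Tr(E_{α,k}²) = x for all α, k; (iv) Tr(E_{α,k}E_{α,l}) = (d−Mx)/(M(M−1)) for all α and all k ≠ l; (v) Tr(E_{α,k}E_{β,l}) = d/M²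 for all α ≠ β and all k, l. -/
open Matrix Kronecker
open scoped ComplexOrder

noncomputable section

/-- The sum G_α = ∑_{k} G_{α,k}. -/
def Gsum {d N M' : ℕ} (G : Fin N → Fin M' → Matrix (Fin d) (Fin d) ℂ) (α : Fin N) :
    Matrix (Fin d) (Fin d) ℂ := ∑ k, G α k

/-- The operators H_{α,k}: for k = 1,…,M−1 (indices with (k:ℕ) < M−1),
H_{α,k} = G_α − √M(√M+1)·G_{α,k}; for k = M (the last index), H_{α,M} = (√M+1)·G_α. -/
def Hop {d N M : ℕ} (G : Fin N → Fin (M - 1) → Matrix (Fin d) (Fin d) ℂ)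
    (α : Fin N) (k : Fin M) : Matrix (Fin d) (Fin d) ℂ :=
  if h : (k : ℕ) < M - 1 then
    Gsum G α - ((Real.sqrt M * (Real.sqrt M + 1) : ℝ) : ℂ) • G α ⟨(k : ℕ), h⟩
  else ((Real.sqrt M + 1 : ℝ) : ℂ) • Gsum G α

/-- The candidate POVM elements E_{α,k} = I_d/M + t·H_{α,k}. -/
def Epovm {d N M : ℕ} (G : Fin N → Fin (M - 1) → Matrix (Fin d) (Fin d) ℂ)
    (t : ℝ) (α : Fin N) (k : Fin M) : Matrix (Fin d) (Fin d) ℂ :=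
  (((1 : ℝ) / M : ℝ) : ℂ) • 1 + (t : ℂ) • Hop G α k

section TraceRelations

variable {d N M : ℕ} {G : Fin N → Fin (M - 1) → Matrix (Fin d) (Fin d) ℂ}

lemma trace_Gsum (htraceless : ∀ α k, (G α k).trace = 0) (α : Fin N) :
    (Gsum G α).trace = 0 := by
  simp [Gsum, Matrix.trace_sum, htraceless]

lemma trace_Hop (htraceless : ∀ α k, (G α k).trace = 0) (α : Fin N) (k : Fin M) :
    (Hop G α k).trace = 0 := by
  unfold Hop
  split_ifs <;> simp [trace_Gsum htraceless, htraceless]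

lemma trace_mul_Gsum (horth : ∀ α k β l, (G α k * G β l).trace = if α = β ∧ k = l then 1 else 0)
    (α β : Fin N) (k : Fin (M - 1)) :
    (G α k * Gsum G β).trace = if α = β then 1 else 0 := by
  by_cases h : α = β <;> simp [Gsum, Finset.mul_sum, Matrix.trace_sum, horth, h]

lemma trace_Gsum_mul (horth : ∀ α k β l, (G α k * G β l).trace = if α = β ∧ k = l then 1 else 0)
    (α β : Fin N) (l : Fin (M - 1)) :
    (Gsum G α * G β l).trace = if α = β then 1 else 0 := by
  rw [Matrix.trace_mul_comm, trace_mul_Gsum horth]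
  simp [eq_comm]

lemma trace_Gsum_mul_Gsum (hM : 1 ≤ M)
    (horth : ∀ α k β l, (G α k * G β l).trace = if α = β ∧ k = l then 1 else 0)
    (α β : Fin N) :
    (Gsum G α * Gsum G β).trace = if α = β then (M : ℂ) - 1 else 0 := by
  conv_lhs => arg 1; arg 1; unfold Gsum
  by_cases h : α = β <;>
    simp [Finset.sum_mul, Matrix.trace_sum, trace_mul_Gsum horth, h, Nat.cast_sub hM]

lemma trace_Hop_mul_Hop (hM : 1 ≤ M)
    (horth : ∀ α k β l, (G α k * G β l).trace = if α = β ∧ k = l then 1 else 0)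
    (α β : Fin N) (k l : Fin M) :
    (Hop G α k * Hop G β l).trace =
      if α = β then
        if k = l then ((M : ℂ) - 1) * ((Real.sqrt M : ℂ) + 1) ^ 2
        else -((Real.sqrt M : ℂ) + 1) ^ 2
      else 0 := by
  have hs : (M : ℂ) = (Real.sqrt M : ℂ) ^ 2 := by
    rw [← Complex.ofReal_pow, Real.sq_sqrt (Nat.cast_nonneg M), Complex.ofReal_natCast]
  unfold Hop
  split_ifs with hk hl <;>
    simp_all [sub_mul, mul_sub, trace_mul_Gsum horth, trace_Gsum_mul horth,
      trace_Gsum_mul_Gsum hM horth, Fin.ext_iff] <;>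
    first
      | omega
      | ring

lemma sum_Hop (hM : 1 ≤ M) (α : Fin N) : ∑ k, Hop G α k = 0 := by
  obtain ⟨m, rfl⟩ : ∃ m, M = m + 1 := ⟨M - 1, by omega⟩
  have hs : (Real.sqrt ((m + 1 : ℕ) : ℝ) : ℂ) ^ 2 = (m : ℂ) + 1 := by
    rw [← Complex.ofReal_pow, Real.sq_sqrt (Nat.cast_nonneg _)]
    simp
  have hG : ∑ k : Fin m, G α k = Gsum G α := rfl
  have hcast (k : Fin m) : Hop G α k.castSucc =
      Gsum G α - ((Real.sqrt (m + 1 : ℕ) * (Real.sqrt (m + 1 : ℕ) + 1) : ℝ) : ℂ) • G α k := by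
    simp [Hop]
  have hlast : Hop G α (Fin.last m) = ((Real.sqrt (m + 1 : ℕ) + 1 : ℝ) : ℂ) • Gsum G α := by
    simp [Hop]
  rw [Fin.sum_univ_castSucc, hlast, Finset.sum_congr rfl fun k _ => hcast k,
    Finset.sum_sub_distrib, ← Finset.smul_sum, hG, Finset.sum_const, Finset.card_univ,
    Fintype.card_fin, ← Nat.cast_smul_eq_nsmul ℂ, ← sub_smul, ← add_smul]
  refine smul_eq_zero_of_left ?_ _
  push_cast at hs ⊢
  linear_combination -hs

lemma trace_Epovm_mul_Epovm (htraceless : ∀ α k, (G α k).trace = 0) (t : ℝ)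
    (α β : Fin N) (k l : Fin M) :
    (Epovm G t α k * Epovm G t β l).trace =
      (d : ℂ) / (M : ℂ) ^ 2 + (t : ℂ) ^ 2 * (Hop G α k * Hop G β l).trace := by
  simp [Epovm, add_mul, mul_add, trace_Hop htraceless]
  ring

end TraceRelations

/-- the operators E_{α,k} built from an orthonormal traceless
Hermitian family satisfy the (N,M)-POVM trace relations with
x = d/M² + t²(M−1)(√M+1)². -/
theorem povm_construction_from_basis (d N M : ℕ) (hd : 2 ≤ d) (hN : 2 ≤ N) (hM : 2 ≤ M)
    (hdim : N * (M - 1) = d ^ 2 - 1)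
    (G : Fin N → Fin (M - 1) → Matrix (Fin d) (Fin d) ℂ)
    (hherm : ∀ α k, (G α k).IsHermitian)
    (htraceless : ∀ α k, (G α k).trace = 0)
    (horth : ∀ α k β l,
      ((G α k)ᴴ * G β l).trace = if α = β ∧ k = l then 1 else 0)
    (t : ℝ) :
    (∀ α, ∑ k, Epovm G t α k = 1) ∧
    (∀ α k, (Epovm G t α k).trace = (d : ℂ) / M) ∧
    (∀ α k, (Epovm G t α k * Epovm G t α k).trace =
      (((d : ℝ) / (M : ℝ) ^ 2 + t ^ 2 * ((M : ℝ) - 1) * (Real.sqrt M + 1) ^ 2 : ℝ) : ℂ)) ∧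
    (∀ α k l, k ≠ l → (Epovm G t α k * Epovm G t α l).trace =
      ((d : ℂ) - (M : ℂ) *
        (((d : ℝ) / (M : ℝ) ^ 2 + t ^ 2 * ((M : ℝ) - 1) * (Real.sqrt M + 1) ^ 2 : ℝ) : ℂ)) /
        ((M : ℂ) * ((M : ℂ) - 1))) ∧
    (∀ α β k l, α ≠ β → (Epovm G t α k * Epovm G t β l).trace = (d : ℂ) / (M : ℂ) ^ 2) := by
  have horth' : ∀ α k β l, (G α k * G β l).trace = if α = β ∧ k = l then 1 else 0 := by
    intro α k β l
    rw [← horth, (hherm α k).eq]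
  have hM1 : 1 ≤ M := by omega
  have hM0 : (M : ℂ) ≠ 0 := Nat.cast_ne_zero.mpr (by omega)
  have hMsub : (M : ℂ) - 1 ≠ 0 := sub_ne_zero.mpr (Nat.cast_ne_one.mpr (by omega))
  refine ⟨fun α => ?_, fun α k => ?_, fun α k => ?_, fun α k l hkl => ?_,
    fun α β k l hαβ => ?_⟩
  · simp only [Epovm, Finset.sum_add_distrib, ← Finset.smul_sum, sum_Hop hM1 α]
    simp [← Nat.cast_smul_eq_nsmul ℂ, smul_smul, hM0]
  · simp [Epovm, trace_Hop htraceless]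
    ring
  · rw [trace_Epovm_mul_Epovm htraceless, trace_Hop_mul_Hop hM1 horth', if_pos rfl, if_pos rfl]
    push_cast
    ring
  · rw [trace_Epovm_mul_Epovm htraceless, trace_Hop_mul_Hop hM1 horth', if_pos rfl, if_neg hkl]
    push_cast
    field_simp
    ring
  · rw [trace_Epovm_mul_Epovm htraceless, trace_Hop_mul_Hop hM1 horth', if_neg hαβ]
    simp
end
end

section
/- Let d ≥ 2, N, M ≥ 2 be integers with N(M−1) = d²−1, let {E_{α,k}} be an informationally complete (N,M)-POVM on ℂ^d with parameter x, let O^{(1)},…,O^{(N)} be M×M real orthogonal matrices each fixing the all-ones vector, let 1 ≤ k ≤ d, let h_x = (1/(kd−1))·√(M(M−1)/(x(M²x−d))), set α₀ = (M+Nd·h_x)/(dM), and let W_k be the associated witness operator. For v ∈ (0,1] let ρ_v = v·|ψ_d⟩⟨ψ_d| + ((1−v)/d²)·I_{d²} be the isotropic state, where |ψ_d⟩ = (1/√d)·∑_{i=0}^{d−1}|i⟩⊗|i⟩. Then Tr(W_k ρ_v) = α₀ − h_x(1−v)N/M − v·h_x·[ (x − (d−Mx)/(M(M−1)))·(1/d)·∑_{α=1}^{N}∑_{g=1}^{M}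 O^{(α)}_{gg} + N(d−Mx)/((M−1)d) ]. -/
open Matrix Kronecker
open scoped ComplexOrder

noncomputable section

lemma proj_psiD_apply {d : ℕ} (p q : Fin d × Fin d) :
    proj (psiD d) p q = if p.1 = p.2 then (if q.1 = q.2 then (1 / d : ℂ) else 0) else 0 := by
  have h : (((√(d : ℝ))⁻¹ : ℝ) : ℂ) * (((√(d : ℝ))⁻¹ : ℝ) : ℂ) = (d : ℂ)⁻¹ := by
    rw [← Complex.ofReal_mul, ← mul_inv, Real.mul_self_sqrt (Nat.cast_nonneg d)]
    simp
  unfold proj psiD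
  rw [Matrix.vecMulVec_apply]
  by_cases hp : p.1 = p.2 <;> by_cases hq : q.1 = q.2 <;> simp [hp, hq]
  simpa using h

lemma trace_mul_proj_psiD {d : ℕ} (X : Matrix (Fin d × Fin d) (Fin d × Fin d) ℂ) :
    (X * proj (psiD d)).trace = (1 / d : ℂ) * ∑ i, ∑ j, X (i, i) (j, j) := by
  simp only [Matrix.trace, Matrix.diag, Matrix.mul_apply, proj_psiD_apply, Fintype.sum_prod_type,
    mul_ite, mul_zero, Finset.sum_ite_eq, Finset.mem_univ, if_true,
    Finset.sum_ite_irrel, Finset.sum_const_zero, Finset.mul_sum]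
  refine Finset.sum_congr rfl fun i _ => Finset.sum_congr rfl fun j _ => ?_
  ring

lemma trace_proj_psiD {d : ℕ} (hd : d ≠ 0) : (proj (psiD d)).trace = 1 := by
  have h := trace_mul_proj_psiD (d := d) 1
  have hd' : (d : ℂ) ≠ 0 := Nat.cast_ne_zero.mpr hd
  rw [Matrix.one_mul] at h
  rw [h]
  simp [Matrix.one_apply, hd']

lemma trace_conj_kronecker_mul_proj_psiD {d : ℕ} {A : Matrix (Fin d) (Fin d) ℂ}
    (hA : A.IsHermitian) (B : Matrix (Fin d) (Fin d) ℂ) :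
    ((A.map (starRingEnd ℂ) ⊗ₖ B) * proj (psiD d)).trace = (1 / d : ℂ) * (A * B).trace := by
  rw [trace_mul_proj_psiD, Finset.sum_comm]
  congr 1
  simp only [Matrix.trace, Matrix.diag, Matrix.mul_apply, Matrix.kroneckerMap_apply,
    Matrix.map_apply]
  refine Finset.sum_congr rfl fun i _ => Finset.sum_congr rfl fun j _ => ?_
  rw [← hA.apply i j]
  rfl

lemma trace_map_conj {n : Type*} [Fintype n] {A : Matrix n n ℂ} (hA : A.IsHermitian) :
    (A.map (starRingEnd ℂ)).trace = A.trace := by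
  refine Finset.sum_congr rfl fun i _ => ?_
  exact hA.apply i i

/-- the value of Tr(W_k ρ_v) on the isotropic state. -/
theorem witness_on_isotropic (d N M k : ℕ) (hd : 2 ≤ d) (hN : 2 ≤ N) (hM : 2 ≤ M)
    (hdim : N * (M - 1) = d ^ 2 - 1) (x : ℝ)
    (E : Fin N → Fin M → Matrix (Fin d) (Fin d) ℂ) (hE : IsICPOVM d N M x E)
    (O : Fin N → Matrix (Fin M) (Fin M) ℝ)
    (hO : ∀ α, (O α)ᵀ * O α = 1)
    (hOnes : ∀ α, (O α).mulVec (fun _ => 1) = fun _ => 1)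
    (hk1 : 1 ≤ k) (hkd : k ≤ d)
    (v : ℝ) (hv0 : 0 < v) (hv1 : v ≤ 1) :
    (Wit E O (hx d M k x) * isoState d v).trace =
      ((((M : ℝ) + N * d * hx d M k x) / (d * M) -
          hx d M k x * (1 - v) * N / M -
          v * hx d M k x *
            ((x - ((d : ℝ) - M * x) / ((M : ℝ) * ((M : ℝ) - 1))) * (1 / (d : ℝ)) *
                (∑ α, ∑ g, O α g g) +
              (N : ℝ) * ((d : ℝ) - M * x) / (((M : ℝ) - 1) * d)) : ℝ) : ℂ) := by
  obtain ⟨hpos, -, htr, hsq, hne, -, -⟩ := hE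
  have hherm : ∀ α l, (E α l).IsHermitian := fun α l => (hpos α l).isHermitian
  have hd0 : (d : ℂ) ≠ 0 := Nat.cast_ne_zero.mpr (by omega)
  have hM0 : (M : ℂ) ≠ 0 := Nat.cast_ne_zero.mpr (by omega)
  have hM1 : (M : ℂ) - 1 ≠ 0 := by
    rw [sub_ne_zero]
    exact_mod_cast (by omega : M ≠ 1)
  have hrow : ∀ α g, ∑ l, ((O α g l : ℝ) : ℂ) = 1 := by
    intro α g
    have h := congrFun (hOnes α) g
    simp only [Matrix.mulVec, dotProduct, mul_one] at h
    exact_mod_cast h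
  set h := hx d M k x
  set y : ℂ := ((d : ℂ) - M * x) / (M * (M - 1)) with hy
  have hoverlap : ∀ α g l, (E α l * E α g).trace = y + if l = g then (x : ℂ) - y else 0 := by
    intro α g l
    by_cases hlg : l = g
    · subst hlg
      simp [hsq]
    · simp [hlg, hne α l g hlg, hy]
  have hproj : (Wit E O h * proj (psiD d)).trace =
      ((((M : ℝ) + N * d * h) / (d * M) : ℝ) : ℂ) -
        h * ((1 / d : ℂ) * (N * M * y + (x - y) * ∑ α, ∑ g, ((O α g g : ℝ) : ℂ))) := by
    simp only [Wit, Matrix.sub_mul, Matrix.smul_mul, Matrix.one_mul, Matrix.sum_mul,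
      Matrix.trace_sub, Matrix.trace_smul, Matrix.trace_sum, smul_eq_mul,
      trace_proj_psiD (d := d) (by omega), trace_conj_kronecker_mul_proj_psiD (hherm _ _),
      hoverlap]
    have hterm : ∀ α g, ∑ l, ((O α g l : ℝ) : ℂ) *
        ((1 / d : ℂ) * (y + if l = g then (x : ℂ) - y else 0)) =
        (1 / d : ℂ) * (y + (x - y) * ((O α g g : ℝ) : ℂ)) := by
      intro α g
      have h1 : ∀ l, ((O α g l : ℝ) : ℂ) *
          ((1 / d : ℂ) * (y + if l = g then (x : ℂ) - y else 0)) =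
          (1 / d : ℂ) * y * ((O α g l : ℝ) : ℂ) +
            if l = g then (1 / d : ℂ) * (x - y) * ((O α g l : ℝ) : ℂ) else 0 := by
        intro l
        split_ifs <;> ring
      simp only [h1, Finset.sum_add_distrib, ← Finset.mul_sum, hrow, Finset.sum_ite_eq',
        Finset.mem_univ, if_true]
      ring
    simp only [hterm, ← Finset.mul_sum, Finset.sum_add_distrib, Finset.sum_const,
      Finset.card_univ, Fintype.card_fin, nsmul_eq_mul]
    ring
  have htrace : (Wit E O h).trace =
      ((((M : ℝ) + N * d * h) / (d * M) : ℝ) : ℂ) * (d * d) -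
        h * (N * M * ((d / M) * (d / M))) := by
    simp only [Wit, Matrix.trace_sub, Matrix.trace_smul, Matrix.trace_sum, smul_eq_mul,
      Matrix.trace_kronecker, trace_map_conj (hherm _ _), htr, ← Finset.sum_mul, hrow,
      Matrix.trace_one, Fintype.card_prod, Fintype.card_fin, Finset.sum_const,
      Finset.card_univ, nsmul_eq_mul]
    push_cast
    ring
  rw [isoState, Matrix.mul_add, Matrix.trace_add, Matrix.mul_smul, Matrix.mul_smul,
    Matrix.mul_one, Matrix.trace_smul, Matrix.trace_smul, hproj, htrace, hy]
  push_cast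
  simp only [smul_eq_mul]
  field_simp
  ring
end
end

section
/- Let d ≥ 2, N, M ≥ 2 be integers with N(M−1) = d²−1, let {E_{α,k}} be an informationally complete (N,M)-POVM on ℂ^d with parameter x, and let 1 ≤ k ≤ d. For v ∈ (0,1] let ρ_v = v·|ψ_d⟩⟨ψ_d| + ((1−v)/d²)·I_{d²} with |ψ_d⟩ = (1/√d)·∑_{i=0}^{d−1}|i⟩⊗|i⟩. If v > M(kd−1)·√(x(M²x−d)) / ( N(M²x−d)·√(M(M−1)) ), then the Schmidt number of ρ_v is greater than k; that is, ρ_v is not a finite convex combination ∑_i p_i |ψ_i⟩⟨ψ_i| of pure states ψ_i ∈ ℂ^d ⊗ ℂ^d of Schmidt rank at most k. -/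
open Matrix Kronecker
open scoped ComplexOrder

noncomputable section

/-- Cauchy-Schwarz for the Frobenius inner product of `A` with the projection onto its range. -/
theorem norm_trace_sq_le_rank_mul {n : Type*} [Fintype n] [DecidableEq n] (A : Matrix n n ℂ) :
    ‖A.trace‖ ^ 2 ≤ A.rank * ∑ i, ∑ j, ‖A i j‖ ^ 2 := by
  classical
  set b := EuclideanSpace.basisFun n ℂ with hb
  set T := A.toEuclideanLin with hT
  set S := LinearMap.range T with hS
  have hrank : A.rank = Module.finrank ℂ S := by
    rw [hS, hT, Matrix.toEuclideanLin_eq_toLin_orthonormal]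
    exact A.rank_eq_finrank_range_toLin _ _
  have hTapp (i j : n) : T (b j) i = A i j := by
    simp [hT, hb, Matrix.toEuclideanLin, Matrix.toLpLin_apply]
  have htr : A.trace = ∑ i, inner ℂ (S.starProjection (b i)) (T (b i)) := by
    refine Finset.sum_congr rfl fun i _ => ?_
    rw [S.inner_starProjection_left_eq_right,
      S.starProjection_eq_self_iff.2 (LinearMap.mem_range_self T (b i)), ← b.repr_apply_apply]
    simp [hb, ← hTapp]
  have hP : ∑ i, ‖S.starProjection (b i)‖ ^ 2 = A.rank := by
    have h1 : LinearMap.trace ℂ _ (S.starProjection : _ →ₗ[ℂ] _) = (Module.finrank ℂ S : ℂ) :=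
      LinearMap.IsProj.trace (p := S) ⟨fun x => S.starProjection_apply_mem x,
        fun x hx => S.starProjection_eq_self_iff.2 hx⟩
    rw [LinearMap.trace_eq_sum_inner _ b] at h1
    have h2 (i : n) : inner ℂ (b i) (S.starProjection (b i)) =
        ((‖S.starProjection (b i)‖ ^ 2 : ℝ) : ℂ) := by
      have h3 := inner_self_eq_norm_sq_to_K (𝕜 := ℂ) (S.starProjection (b i))
      rw [S.inner_starProjection_left_eq_right, S.starProjection_eq_self_iff.2
        (S.starProjection_apply_mem _)] at h3
      rw [h3]
      simp
    simp only [ContinuousLinearMap.coe_coe, h2] at h1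
    rw [hrank]
    exact_mod_cast h1
  have hF : ∑ i, ‖T (b i)‖ ^ 2 = ∑ i, ∑ j, ‖A i j‖ ^ 2 := by
    simp_rw [EuclideanSpace.norm_sq_eq, hTapp]
    exact Finset.sum_comm
  have hle : ‖A.trace‖ ≤ ∑ i, ‖S.starProjection (b i)‖ * ‖T (b i)‖ := by
    rw [htr]
    exact (norm_sum_le _ _).trans (Finset.sum_le_sum fun i _ => norm_inner_le_norm _ _)
  rw [← hP, ← hF]
  exact (pow_le_pow_left₀ (norm_nonneg _) hle 2).trans (Finset.sum_mul_sq_le_sq_mul_sq _ _ _)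

/-- `d` times the fidelity of `ρ` with the maximally entangled state. -/
def diagSum {d : ℕ} (ρ : Matrix (Fin d × Fin d) (Fin d × Fin d) ℂ) : ℂ :=
  ∑ i, ∑ j, ρ (i, i) (j, j)

theorem diagSum_proj {d : ℕ} (ψ : Fin d × Fin d → ℂ) :
    diagSum (proj ψ) = ((‖(Matrix.of fun a b => ψ (a, b)).trace‖ ^ 2 : ℝ) : ℂ) := by
  have h := Complex.mul_conj' (Matrix.of fun a b => ψ (a, b)).trace
  rw [Complex.ofReal_pow, ← h]
  simp [diagSum, proj, Matrix.vecMulVec_apply, Matrix.trace, Finset.sum_mul_sum]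

theorem diagSum_isoState {d : ℕ} (hd : 0 < d) (v : ℝ) :
    diagSum (isoState d v) = ((v * d + (1 - v) / d : ℝ) : ℂ) := by
  have hd' : (d : ℂ) ≠ 0 := by exact_mod_cast hd.ne'
  have hs : ((√(d : ℝ) : ℝ) : ℂ) * ((√(d : ℝ) : ℝ) : ℂ) = d := by
    rw [← Complex.ofReal_mul, Real.mul_self_sqrt (Nat.cast_nonneg d), Complex.ofReal_natCast]
  have hs' : ((√(d : ℝ) : ℝ) : ℂ)⁻¹ * ((√(d : ℝ) : ℝ) : ℂ)⁻¹ = (d : ℂ)⁻¹ := by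
    rw [← mul_inv, hs]
  simp only [diagSum, isoState, proj, psiD, Matrix.add_apply, Matrix.smul_apply,
    Matrix.vecMulVec_apply, Matrix.one_apply, Prod.mk.injEq, and_self, if_true, Pi.star_apply,
    Finset.sum_add_distrib]
  simp [hs']
  field_simp

/-- A state of Schmidt number at most `k` has fidelity at most `k / d` with `ψ_d`. -/
theorem SchmidtNumberLE.re_diagSum_le {d k : ℕ}
    {ρ : Matrix (Fin d × Fin d) (Fin d × Fin d) ℂ} (h : SchmidtNumberLE d k ρ) :
    (diagSum ρ).re ≤ k := by
  obtain ⟨n, p, ψ, hp, hsum, hnorm, hrank, rfl⟩ := h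
  have hlin : diagSum (∑ i, ((p i : ℝ) : ℂ) • proj (ψ i)) =
      ∑ i, ((p i : ℝ) : ℂ) * diagSum (proj (ψ i)) := by
    simp only [diagSum, Matrix.sum_apply, Matrix.smul_apply, smul_eq_mul, Finset.mul_sum]
    exact (Finset.sum_congr rfl fun _ _ => Finset.sum_comm).trans Finset.sum_comm
  have hbound (i : Fin n) : ‖(Matrix.of fun a b => ψ i (a, b)).trace‖ ^ 2 ≤ k := by
    have h1 := norm_trace_sq_le_rank_mul (Matrix.of fun a b => ψ i (a, b))
    have h2 : ∑ a, ∑ b, ‖(Matrix.of fun a b => ψ i (a, b)) a b‖ ^ 2 = 1 := by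
      rw [← hnorm i, Fintype.sum_prod_type]
      rfl
    rw [h2, mul_one] at h1
    exact h1.trans (by exact_mod_cast hrank i)
  rw [hlin, Complex.re_sum]
  calc _ ≤ ∑ i, p i * (k : ℝ) := by
        refine Finset.sum_le_sum fun i _ => ?_
        rw [diagSum_proj, ← Complex.ofReal_mul, Complex.ofReal_re]
        exact mul_le_mul_of_nonneg_left (hbound i) (hp i)
    _ = k := by rw [← Finset.sum_mul, hsum, one_mul]

theorem inv_sub_one_le_sqrt_div {M d x : ℝ} (hM : 1 < M) (hd : d < M ^ 2 * x) (hx : M * x ≤ d) :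
    1 / (M - 1) ≤ M * √(x * (M ^ 2 * x - d)) / ((M ^ 2 * x - d) * √(M * (M - 1))) := by
  have hM0 : 0 < M - 1 := by linarith
  have hM1 : 0 < M := by linarith
  have hy : 0 < M ^ 2 * x - d := by linarith
  have hpos : 0 < M * (M - 1) := mul_pos hM1 hM0
  have hs : 0 < √(M * (M - 1)) := Real.sqrt_pos.2 hpos
  rw [div_le_div_iff₀ hM0 (mul_pos hy hs), one_mul]
  have key : (M ^ 2 * x - d) ^ 2 * (M * (M - 1)) ≤
      (M * (M - 1)) ^ 2 * (x * (M ^ 2 * x - d)) := by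
    have h : 0 ≤ (M * (M - 1)) * (M ^ 2 * x - d) * (d - M * x) :=
      mul_nonneg (mul_pos hpos hy).le (by linarith)
    nlinarith
  have h := Real.sqrt_le_sqrt key
  rw [Real.sqrt_mul (sq_nonneg _), Real.sqrt_mul (sq_nonneg _), Real.sqrt_sq hy.le,
    Real.sqrt_sq hpos.le] at h
  linarith

/-- for v above the threshold, the isotropic state ρ_v has Schmidt
number greater than k. -/
theorem isotropic_schmidt_number_gt (d N M k : ℕ)
    (hd : 2 ≤ d) (hN : 2 ≤ N) (hM : 2 ≤ M)
    (hdim : N * (M - 1) = d ^ 2 - 1) (x : ℝ)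
    (E : Fin N → Fin M → Matrix (Fin d) (Fin d) ℂ) (hE : IsICPOVM d N M x E)
    (hk1 : 1 ≤ k) (hkd : k ≤ d)
    (v : ℝ) (hv0 : 0 < v) (hv1 : v ≤ 1)
    (hv : (M : ℝ) * ((k : ℝ) * d - 1) * Real.sqrt (x * ((M : ℝ) ^ 2 * x - d)) /
        ((N : ℝ) * ((M : ℝ) ^ 2 * x - d) * Real.sqrt ((M : ℝ) * ((M : ℝ) - 1))) < v) :
    ¬ SchmidtNumberLE d k (isoState d v) := by
  intro h
  have hle := h.re_diagSum_le
  rw [diagSum_isoState (by omega), Complex.ofReal_re] at hle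
  obtain ⟨-, -, -, -, -, -, hx1, hx2⟩ := hE
  have hMr : (2 : ℝ) ≤ M := by exact_mod_cast hM
  have hdr : (2 : ℝ) ≤ d := by exact_mod_cast hd
  have hNr : (2 : ℝ) ≤ N := by exact_mod_cast hN
  have hkr : (1 : ℝ) ≤ k := by exact_mod_cast hk1
  have hdimr : (N : ℝ) * (M - 1) = d ^ 2 - 1 := by
    have h1 : 1 ≤ d ^ 2 := Nat.one_le_pow _ _ (by omega)
    have := congrArg (Nat.cast : ℕ → ℝ) hdim
    rw [Nat.cast_mul, Nat.cast_sub (by omega), Nat.cast_sub h1] at this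
    exact_mod_cast this
  have hMx : (M : ℝ) * x ≤ d := by
    have := (le_div_iff₀ (by linarith : (0 : ℝ) < M)).1 (hx2.trans (min_le_right _ _))
    linarith
  have hdx : (d : ℝ) < (M : ℝ) ^ 2 * x := by
    have := (div_lt_iff₀ (by positivity : (0 : ℝ) < (M : ℝ) ^ 2)).1 hx1
    linarith
  have hthr := inv_sub_one_le_sqrt_div (by linarith : (1 : ℝ) < M) hdx hMx
  have hc : 0 ≤ ((k : ℝ) * d - 1) / N := div_nonneg (by nlinarith) (by linarith)
  have hmul := mul_le_mul_of_nonneg_left hthr hc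
  have hlt : ((k : ℝ) * d - 1) / (d ^ 2 - 1) < v := by
    refine lt_of_le_of_lt ?_ hv
    rw [← hdimr]
    convert hmul using 1
    · rw [div_mul_div_comm, mul_one]
    · rw [div_mul_div_comm]
      congr 1 <;> ring
  rw [div_lt_iff₀ (by nlinarith)] at hlt
  have hd0 : (0 : ℝ) < d := by linarith
  have hle' := mul_le_mul_of_nonneg_right hle hd0.le
  rw [add_mul, div_mul_cancel₀ _ hd0.ne'] at hle'
  nlinarith
end
end
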